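/- Let 0 < ε < 1/384 and let f encode a smooth embedded paper Moebius band of aspect ratio λ with λ < √3 + ε, with image Ω = f '' (ℝ × [0,1]). Then there exist points A, B, C ∈ ℝ³ with pairwise distances 2√3/3 such that the Hausdorff distance between Ω and the equilateral triangle convexHull ℝ {A, B, C} is at most 18√ε. -/

import Mathlib

namespace PaperBand

open Set Filter Topology
open scoped ContDiff RealInnerProductSpace

/-! ### Iterated directional derivatives of smooth maps on the plane -/

section DirDeriv

variable {G : Type*} [NormedAddCommGroup G] [NormedSpace ℝ G]

/-- The directional derivative of `g` in the constant direction `v`. -/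
noncomputable def dirDeriv (v : ℝ × ℝ) (g : ℝ × ℝ → G) : ℝ × ℝ → G :=
  fun p => fderiv ℝ g p v

theorem contDiff_dirDeriv {g : ℝ × ℝ → G} (hg : ContDiff ℝ ∞ g) (v : ℝ × ℝ) :
    ContDiff ℝ ∞ (dirDeriv v g) := by
  have h : ContDiff ℝ ∞ (fderiv ℝ g) := hg.fderiv_right (m := ∞) (by simp)
  exact h.clm_apply contDiff_const

theorem differentiable_of_smooth {g : ℝ × ℝ → G} (hg : ContDiff ℝ ∞ g) :
    Differentiable ℝ g :=
  hg.differentiable (by simp)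

theorem dirDeriv_comm {g : ℝ × ℝ → G} (hg : ContDiff ℝ ∞ g) (v w : ℝ × ℝ) :
    dirDeriv v (dirDeriv w g) = dirDeriv w (dirDeriv v g) := by
  have h : Differentiable ℝ (fderiv ℝ g) :=
    (hg.fderiv_right (m := ∞) (by simp)).differentiable (by simp)
  have key : ∀ (v w p : ℝ × ℝ),
      dirDeriv v (dirDeriv w g) p = fderiv ℝ (fderiv ℝ g) p v w := by
    intro v w p
    have := ((h p).hasFDerivAt.clm_apply (hasFDerivAt_const w p)).fderiv
    change fderiv ℝ (fun q => fderiv ℝ g q w) p v = _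
    rw [this]
    simp
  funext p
  rw [key, key]
  exact (hg.contDiffAt (x := p)).isSymmSndFDerivAt (by
    simpa using WithTop.coe_le_coe.2 (le_top (a := (2 : ℕ∞)))) v w

theorem dirDeriv_add_left (g : ℝ × ℝ → G) (v w p : ℝ × ℝ) :
    dirDeriv (v + w) g p = dirDeriv v g p + dirDeriv w g p :=
  map_add _ _ _

theorem dirDeriv_smul_left (g : ℝ × ℝ → G) (c : ℝ) (v p : ℝ × ℝ) :
    dirDeriv (c • v) g p = c • dirDeriv v g p :=
  map_smul _ _ _

theorem dirDeriv_fun_add {g h : ℝ × ℝ → G} (hg : ContDiff ℝ ∞ g) (hh : ContDiff ℝ ∞ h)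
    (v p : ℝ × ℝ) :
    dirDeriv v (fun q => g q + h q) p = dirDeriv v g p + dirDeriv v h p := by
  simp only [dirDeriv]
  rw [fderiv_fun_add (differentiable_of_smooth hg p) (differentiable_of_smooth hh p)]
  rfl

theorem dirDeriv_fun_smul {g : ℝ × ℝ → G} (hg : ContDiff ℝ ∞ g) (c : ℝ) (v p : ℝ × ℝ) :
    dirDeriv v (fun q => c • g q) p = c • dirDeriv v g p := by
  simp only [dirDeriv]
  rw [fderiv_fun_const_smul (differentiable_of_smooth hg p)]
  rfl

theorem dirDeriv_mul {g h : ℝ × ℝ → ℝ} (hg : ContDiff ℝ ∞ g) (hh : ContDiff ℝ ∞ h)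
    (v p : ℝ × ℝ) :
    dirDeriv v (fun q => g q * h q) p = g p * dirDeriv v h p + dirDeriv v g p * h p := by
  simp only [dirDeriv]
  rw [fderiv_fun_mul (differentiable_of_smooth hg p) (differentiable_of_smooth hh p)]
  simp [mul_comm]

theorem dirDeriv_congr {g h : ℝ × ℝ → G} {U : Set (ℝ × ℝ)} (hU : IsOpen U)
    (hgh : ∀ p ∈ U, g p = h p) (v : ℝ × ℝ) : ∀ p ∈ U, dirDeriv v g p = dirDeriv v h p := by
  intro p hp
  have : g =ᶠ[𝓝 p] h := by
    filter_upwards [hU.mem_nhds hp] with q hq using hgh q hq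
  simp only [dirDeriv, this.fderiv_eq]

theorem hasDerivAt_comp_line {g : ℝ × ℝ → G} (hg : ContDiff ℝ ∞ g) (p v : ℝ × ℝ) (t : ℝ) :
    HasDerivAt (fun t : ℝ => g (p + t • v)) (dirDeriv v g (p + t • v)) t := by
  have h1 : HasDerivAt (fun t : ℝ => p + t • v) v t := by
    simpa using ((hasDerivAt_id t).smul_const v).const_add p
  exact ((differentiable_of_smooth hg _).hasFDerivAt).comp_hasDerivAt t h1

end DirDeriv

section InnerDirDeriv

variable {E : Type*} [NormedAddCommGroup E] [InnerProductSpace ℝ E]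

theorem dirDeriv_inner {g h : ℝ × ℝ → E} (hg : ContDiff ℝ ∞ g) (hh : ContDiff ℝ ∞ h)
    (v p : ℝ × ℝ) :
    dirDeriv v (fun q => ⟪g q, h q⟫) p = ⟪g p, dirDeriv v h p⟫ + ⟪dirDeriv v g p, h p⟫ := by
  simp only [dirDeriv]
  rw [fderiv_inner_apply ℝ (differentiable_of_smooth hg p) (differentiable_of_smooth hh p)]

theorem dirDeriv_inner_const {g : ℝ × ℝ → E} (hg : ContDiff ℝ ∞ g) (ν : E) (v : ℝ × ℝ) :
    dirDeriv v (fun q => ⟪g q, ν⟫) = fun p => ⟪dirDeriv v g p, ν⟫ := by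
  funext p
  rw [dirDeriv_inner hg contDiff_const]
  simp [dirDeriv]

end InnerDirDeriv

/-! ### Propagation of the kernel of a degenerate Hessian -/

/-- If the Hessian of `u` is degenerate and nonzero at `p` with kernel direction `k`, then it
stays nonzero with kernel direction `k` along the line through `p` in direction `k`. -/
theorem hessian_kernel_propagates {u : ℝ × ℝ → ℝ} (hu : ContDiff ℝ ∞ u) {U : Set (ℝ × ℝ)}
    (hU : IsOpen U) (e k p : ℝ × ℝ)
    (hdet : ∀ q ∈ U, dirDeriv e (dirDeriv e u) q * dirDeriv k (dirDeriv k u) q =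
      dirDeriv e (dirDeriv k u) q ^ 2)
    {T : ℝ} (hT0 : 0 < T) (hT : ∀ t ∈ Ico 0 T, p + t • k ∈ U)
    (hM : dirDeriv e (dirDeriv k u) p = 0) (hL : dirDeriv e (dirDeriv e u) p ≠ 0) :
    ∀ t ∈ Icc 0 T, dirDeriv e (dirDeriv e u) (p + t • k) ≠ 0 ∧
      dirDeriv e (dirDeriv k u) (p + t • k) = 0 ∧
      dirDeriv k (dirDeriv k u) (p + t • k) = 0 := by
  set L := dirDeriv e (dirDeriv e u) with hLdef
  set M := dirDeriv e (dirDeriv k u) with hMdef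
  set N := dirDeriv k (dirDeriv k u) with hNdef
  have sL : ContDiff ℝ ∞ L := contDiff_dirDeriv (contDiff_dirDeriv hu e) e
  have sM : ContDiff ℝ ∞ M := contDiff_dirDeriv (contDiff_dirDeriv hu k) e
  have sN : ContDiff ℝ ∞ N := contDiff_dirDeriv (contDiff_dirDeriv hu k) k
  have sP : ContDiff ℝ ∞ (dirDeriv e M) := contDiff_dirDeriv sM e
  have hLM : dirDeriv k L = dirDeriv e M := by
    rw [hLdef, hMdef, dirDeriv_comm (contDiff_dirDeriv hu e), dirDeriv_comm hu k e]
  have hMN : dirDeriv k M = dirDeriv e N := by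
    rw [hMdef, hNdef, dirDeriv_comm (contDiff_dirDeriv hu k)]
  have line : Continuous (fun t : ℝ => p + t • k) := by fun_prop
  have d1 : ∀ q ∈ U, L q * dirDeriv e N q + dirDeriv e L q * N q = 2 * M q * dirDeriv e M q := by
    intro q hq
    have h := dirDeriv_congr hU (g := fun q => L q * N q) (h := fun q => M q * M q)
      (fun q hq => by rw [hdet q hq]; ring) e q hq
    rw [dirDeriv_mul sL sN, dirDeriv_mul sM sM] at h
    linarith
  have d2 : ∀ q ∈ U, L q * dirDeriv e (dirDeriv e N) q + 2 * dirDeriv e L q * dirDeriv e N q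
      + dirDeriv e (dirDeriv e L) q * N q
      = 2 * M q * dirDeriv e (dirDeriv e M) q + 2 * dirDeriv e M q ^ 2 := by
    intro q hq
    have h := dirDeriv_congr hU (g := fun q => L q * dirDeriv e N q + dirDeriv e L q * N q)
      (h := fun q => (M q * dirDeriv e M q + M q * dirDeriv e M q))
      (fun q hq => by rw [d1 q hq]; ring) e q hq
    have sNe := contDiff_dirDeriv sN e
    have sLe := contDiff_dirDeriv sL e
    rw [dirDeriv_fun_add (sL.mul sNe) (sLe.mul sN), dirDeriv_fun_add (sM.mul sP) (sM.mul sP),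
      dirDeriv_mul sL sNe, dirDeriv_mul sLe sN, dirDeriv_mul sM sP] at h
    linarith
  -- as long as `L` does not vanish, `M` and `N` vanish
  have good : ∀ τ, τ ≤ T → (∀ t ∈ Ico 0 τ, L (p + t • k) ≠ 0) →
      ∀ t ∈ Ico 0 τ, M (p + t • k) = 0 ∧ N (p + t • k) = 0 := by
    intro τ hτ hne t ht
    have hM0 : M (p + t • k) = 0 := by
      have hcont : ContinuousOn (fun s : ℝ => (2 * dirDeriv e M (p + s • k)
          - M (p + s • k) / L (p + s • k) * dirDeriv e L (p + s • k)) / L (p + s • k))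
          (Icc 0 t) := by
        have hne' : ∀ s ∈ Icc 0 t, L (p + s • k) ≠ 0 :=
          fun s hs => hne s ⟨hs.1, hs.2.trans_lt ht.2⟩
        have c1 : Continuous fun s : ℝ => L (p + s • k) := sL.continuous.comp line
        have c2 : Continuous fun s : ℝ => M (p + s • k) := sM.continuous.comp line
        have c3 : Continuous fun s : ℝ => dirDeriv e M (p + s • k) := sP.continuous.comp line
        have c4 : Continuous fun s : ℝ => dirDeriv e L (p + s • k) :=
          (contDiff_dirDeriv sL e).continuous.comp line
        exact (((continuous_const.mul c3).continuousOn).sub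
          ((c2.continuousOn.div c1.continuousOn hne').mul c4.continuousOn)).div
          c1.continuousOn hne'
      obtain ⟨K, hK⟩ := isCompact_Icc.exists_bound_of_continuousOn hcont
      refine eq_zero_of_abs_deriv_le_mul_abs_self_of_eq_zero_right (K := K)
        (f := fun s : ℝ => M (p + s • k)) (f' := fun s => dirDeriv k M (p + s • k))
        (sM.continuous.comp line).continuousOn
        (fun s _ => (hasDerivAt_comp_line sM p k s).hasDerivWithinAt) (by simpa using hM)
        (fun s hs => ?_) t ⟨ht.1, le_rfl⟩
      have hs' : s ∈ Icc 0 t := ⟨hs.1, hs.2.le⟩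
      refine le_trans (le_of_eq ?_) (mul_le_mul_of_nonneg_right (hK s hs') (norm_nonneg _))
      rw [← norm_mul, hMN]
      congr 1
      have hsU : p + s • k ∈ U := hT s ⟨hs.1, hs.2.trans (ht.2.trans_le hτ)⟩
      have hLs := hne s ⟨hs.1, hs.2.trans ht.2⟩
      have e1 := d1 _ hsU
      have e2 := hdet _ hsU
      have hN : N (p + s • k) = M (p + s • k) ^ 2 / L (p + s • k) := by
        rw [eq_div_iff hLs, ← e2]; ring
      rw [hN] at e1
      field_simp
      field_simp at e1
      linear_combination e1
    refine ⟨hM0, ?_⟩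
    have e2 := hdet _ (hT t ⟨ht.1, ht.2.trans_le hτ⟩)
    rw [hM0] at e2
    simpa [hne t ht] using e2
  have cL : Continuous fun s : ℝ => L (p + s • k) := sL.continuous.comp line
  have cP : Continuous fun s : ℝ => dirDeriv e M (p + s • k) := sP.continuous.comp line
  have hLne : ∀ t ∈ Icc 0 T, L (p + t • k) ≠ 0 := by
    by_contra! hcon
    obtain ⟨t₁, ht₁, hz₁⟩ := hcon
    have hZ : IsCompact (Icc 0 T ∩ (fun s : ℝ => L (p + s • k)) ⁻¹' {0}) :=
      isCompact_Icc.inter_right (isClosed_singleton.preimage cL)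
    obtain ⟨τ, ⟨hτ, hτ0⟩, hmin⟩ := hZ.exists_isLeast ⟨t₁, ht₁, hz₁⟩
    have hτ0 : L (p + τ • k) = 0 := hτ0
    have hne : ∀ t ∈ Ico 0 τ, L (p + t • k) ≠ 0 := fun t ht h0 =>
      absurd (hmin ⟨⟨ht.1, ht.2.le.trans hτ.2⟩, h0⟩) (not_le.2 ht.2)
    have hτpos : 0 < τ := by
      rcases hτ.1.lt_or_eq with h | h
      · exact h
      · exact absurd hτ0 (by rw [← h]; simpa using hL)
    have hg := good τ hτ.2 hne
    set c := dirDeriv e M p / L p ^ 2 with hc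
    -- `dirDeriv e M / L ^ 2` is constant along the line
    have hconst : ∀ t ∈ Ico 0 τ, dirDeriv e M (p + t • k) = c * L (p + t • k) ^ 2 := by
      intro t ht
      have hne' : ∀ s ∈ Icc 0 t, L (p + s • k) ≠ 0 :=
          fun s hs => hne s ⟨hs.1, hs.2.trans_lt ht.2⟩
      have hder : ∀ s ∈ Ico 0 t, HasDerivWithinAt
          (fun s : ℝ => dirDeriv e M (p + s • k) / L (p + s • k) ^ 2) 0 (Ici s) s := by
        intro s hs
        have hsτ : s ∈ Ico 0 τ := ⟨hs.1, hs.2.trans ht.2⟩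
        have hLs := hne s hsτ
        have hD := (hasDerivAt_comp_line sP p k s).div ((hasDerivAt_comp_line sL p k s).pow 2)
          (pow_ne_zero 2 hLs)
        refine HasDerivAt.hasDerivWithinAt ?_
        convert! hD using 1
        have hsU : p + s • k ∈ U := hT s ⟨hs.1, hsτ.2.trans_le hτ.2⟩
        have e1 := d1 _ hsU
        have e2 := d2 _ hsU
        rw [(hg s hsτ).1, (hg s hsτ).2] at e1 e2
        have hNe : dirDeriv e N (p + s • k) = 0 := by simpa [hLs] using e1
        rw [hNe] at e2
        have hPk : dirDeriv k (dirDeriv e M) (p + s • k)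
            = dirDeriv e (dirDeriv e N) (p + s • k) := by
          rw [dirDeriv_comm sM, hMN]
        rw [hPk, hLM]
        simp only [Pi.pow_apply, Nat.cast_ofNat, Nat.add_one_sub_one, pow_one]
        rw [eq_comm, div_eq_zero_iff]
        left
        linear_combination L (p + s • k) * e2
      have := constant_of_has_deriv_right_zero
        (((cP.continuousOn).div ((cL.pow 2).continuousOn)
          (fun s hs => pow_ne_zero 2 (hne' s hs)))) hder t ⟨ht.1, le_rfl⟩
      have hLt := hne t ht
      have h0 : dirDeriv e M (p + t • k) / L (p + t • k) ^ 2 = c := by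
        simpa [hc] using this
      rw [← h0]
      field_simp
    have cL' : Continuous fun s : ℝ => L (p + (τ - s) • k) := sL.continuous.comp (by fun_prop)
    obtain ⟨K, hK⟩ := isCompact_Icc.exists_bound_of_continuousOn
      (s := Icc 0 τ) (f := fun s : ℝ => c * L (p + (τ - s) • k))
      (continuous_const.mul cL').continuousOn
    have := eq_zero_of_abs_deriv_le_mul_abs_self_of_eq_zero_right
      (f := fun s : ℝ => L (p + (τ - s) • k))
      (f' := fun s => -dirDeriv k L (p + (τ - s) • k)) (a := 0) (b := τ)
      (K := K) cL'.continuousOn (fun s _ => by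
        have h1 := (hasDerivAt_comp_line sL p k (τ - s)).scomp s
          ((hasDerivAt_id s).const_sub τ)
        have h2 := h1.hasDerivWithinAt (s := Ici s)
        simpa [Function.comp_def] using h2) (by simpa using hτ0)
      (fun s hs => by
        rcases hs.1.lt_or_eq with h | h
        · rw [hLM, norm_neg, hconst (τ - s) ⟨by linarith [hs.2], by linarith⟩]
          refine le_trans (le_of_eq ?_) (mul_le_mul_of_nonneg_right (hK s ⟨hs.1, hs.2.le⟩)
            (norm_nonneg _))
          rw [← norm_mul]; congr 1; ring
        · have hcl : dirDeriv e M (p + τ • k) = c * L (p + τ • k) ^ 2 := by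
            have hclosed : IsClosed {s : ℝ | dirDeriv e M (p + s • k) = c * L (p + s • k) ^ 2} :=
              isClosed_eq cP (continuous_const.mul (cL.pow 2))
            have hsub : Ico 0 τ ⊆ {s : ℝ | dirDeriv e M (p + s • k) = c * L (p + s • k) ^ 2} :=
              hconst
            have := closure_minimal hsub hclosed
            rw [closure_Ico hτpos.ne] at this
            exact this ⟨hτ.1, le_rfl⟩
          rw [← h, sub_zero, hLM, hcl, hτ0]; simp)
      τ ⟨hτ.1, le_rfl⟩
    simp only [sub_self, zero_smul, add_zero] at this
    exact hL this
  intro t ht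
  refine ⟨hLne t ht, ?_⟩
  rcases ht.2.lt_or_eq with h | h
  · exact good T le_rfl (fun s hs => hLne s ⟨hs.1, hs.2.le⟩) t ⟨ht.1, h⟩
  · subst h
    have hclosed : IsClosed {s : ℝ | M (p + s • k) = 0 ∧ N (p + s • k) = 0} :=
      (isClosed_eq (sM.continuous.comp line) continuous_const).inter
        (isClosed_eq (sN.continuous.comp line) continuous_const)
    have := closure_minimal (good t le_rfl (fun s hs => hLne s ⟨hs.1, hs.2.le⟩) :
      Ico 0 t ⊆ {s : ℝ | M (p + s • k) = 0 ∧ N (p + s • k) = 0}) hclosed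
    rw [closure_Ico hT0.ne] at this
    exact this ht

/-- A smooth map whose second derivative vanishes along an open segment is affine on it. -/
theorem eq_add_smul_of_deriv_eq_zero {G : Type*} [NormedAddCommGroup G] [NormedSpace ℝ G]
    {g : ℝ × ℝ → G} (hg : ContDiff ℝ ∞ g) {p k : ℝ × ℝ} {T : ℝ} (hT0 : 0 < T)
    (h0 : ∀ t ∈ Ioo 0 T, dirDeriv k (dirDeriv k g) (p + t • k) = 0) :
    g (p + T • k) = g p + T • dirDeriv k g p := by
  have line : Continuous (fun t : ℝ => p + t • k) := by fun_prop
  have sk := contDiff_dirDeriv hg k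
  have skk := contDiff_dirDeriv sk k
  have h0' : ∀ t ∈ Icc 0 T, dirDeriv k (dirDeriv k g) (p + t • k) = 0 := by
    have := closure_minimal (h0 : Ioo 0 T ⊆ {t | dirDeriv k (dirDeriv k g) (p + t • k) = 0})
      (isClosed_eq (skk.continuous.comp line) continuous_const)
    rwa [closure_Ioo hT0.ne] at this
  have h1 : ∀ t ∈ Icc 0 T, dirDeriv k g (p + t • k) = dirDeriv k g p := by
    intro t ht
    have := constant_of_has_deriv_right_zero
      (sk.continuous.comp line).continuousOn
      (fun s hs => by
        have := (hasDerivAt_comp_line sk p k s).hasDerivWithinAt (s := Ici s)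
        rwa [h0' s ⟨hs.1, hs.2.le⟩] at this) t ht
    simpa using this
  have := constant_of_has_deriv_right_zero (a := 0) (b := T)
    (f := fun t : ℝ => g (p + t • k) - t • dirDeriv k g p)
    (((hg.continuous.comp line).sub (by fun_prop)).continuousOn)
    (fun s hs => by
      have := ((hasDerivAt_comp_line hg p k s).sub
        ((hasDerivAt_id s).smul_const (dirDeriv k g p))).hasDerivWithinAt (s := Ici s)
      rw [h1 s ⟨hs.1, hs.2.le⟩] at this
      exact this.congr_deriv (by simp)) T ⟨hT0.le, le_rfl⟩
  simp only [zero_smul, add_zero, sub_zero] at this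
  rw [← this]
  abel

/-! ### Isometric maps of the flat strip -/

/-- Euclidean three-space. -/
abbrev Space := EuclideanSpace ℝ (Fin 3)

/-- Paper Moebius bands of aspect ratio `lam`, not necessarily embedded. -/
structure IsMoebius (lam : ℝ) (F : ℝ × ℝ → Space) : Prop where
  pos : 0 < lam
  smooth : ContDiff ℝ ∞ F
  glue : ∀ x : ℝ, ∀ y ∈ Icc (0 : ℝ) 1, F (x + lam, 1 - y) = F (x, y)
  isom : ∀ p : ℝ × ℝ, p.2 ∈ Icc (0 : ℝ) 1 → ∀ v : ℝ × ℝ,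
    ‖fderiv ℝ F p v‖ = Real.sqrt (v.1 ^ 2 + v.2 ^ 2)

/-- The open strip. -/
def openStrip : Set (ℝ × ℝ) := {p | p.2 ∈ Ioo (0 : ℝ) 1}

theorem isOpen_openStrip : IsOpen openStrip := isOpen_Ioo.preimage continuous_snd

theorem ContinuousLinearMap.inner_of_norm_eq {T : ℝ × ℝ →L[ℝ] Space}
    (hT : ∀ v : ℝ × ℝ, ‖T v‖ = Real.sqrt (v.1 ^ 2 + v.2 ^ 2)) (v w : ℝ × ℝ) :
    ⟪T v, T w⟫ = v.1 * w.1 + v.2 * w.2 := by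
  have h : ∀ v : ℝ × ℝ, ‖T v‖ ^ 2 = v.1 ^ 2 + v.2 ^ 2 := fun v => by
    rw [hT, Real.sq_sqrt (by positivity)]
  have h1 := h (v + w)
  rw [map_add, norm_add_sq_real, h v, h w] at h1
  simp only [Prod.fst_add, Prod.snd_add] at h1
  linarith

theorem exists_eq_smul_of_orthogonal {a b : Space} (ha : ⟪a, a⟫ = 1) (hb : ⟪b, b⟫ = 1)
    (hab : ⟪a, b⟫ = 0) :
    ∃ n : Space, n ≠ 0 ∧ ∀ P : Space, ⟪P, a⟫ = 0 → ⟪P, b⟫ = 0 → ∃ r : ℝ, P = r • n := by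
  set K : Submodule ℝ Space := Submodule.span ℝ {a, b}
  have hli : LinearIndependent ℝ ![a, b] := by
    rw [LinearIndependent.pair_iff]
    intro s t hst
    have h1 : ⟪a, s • a + t • b⟫ = 0 := by rw [hst, inner_zero_right]
    have h2 : ⟪b, s • a + t • b⟫ = 0 := by rw [hst, inner_zero_right]
    rw [inner_add_right, inner_smul_right, inner_smul_right, ha, hab] at h1
    rw [inner_add_right, inner_smul_right, inner_smul_right, hb, real_inner_comm, hab] at h2
    exact ⟨by simpa using h1, by simpa using h2⟩
  have hK : Module.finrank ℝ K = 2 := by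
    have := finrank_span_eq_card hli
    rw [Matrix.range_cons_cons_empty] at this
    simpa using this
  have hKo : Module.finrank ℝ Kᗮ = 1 := by
    have := Submodule.finrank_add_finrank_orthogonal K
    rw [hK, finrank_euclideanSpace_fin] at this
    omega
  obtain ⟨n, hn0, hn⟩ := finrank_eq_one_iff'.1 hKo
  refine ⟨n, by simpa using hn0, fun P hPa hPb => ?_⟩
  have hP : P ∈ Kᗮ := by
    rw [Submodule.mem_orthogonal]
    intro u hu
    obtain ⟨s, t, rfl⟩ := Submodule.mem_span_pair.1 hu
    rw [inner_add_left, inner_smul_left, inner_smul_left, real_inner_comm, hPa,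
      real_inner_comm, hPb]
    simp
  obtain ⟨c, hc⟩ := hn ⟨P, hP⟩
  exact ⟨c, by simpa using (congrArg Subtype.val hc).symm⟩

namespace IsMoebius

variable {lam : ℝ} {F : ℝ × ℝ → Space}

theorem inner_dirDeriv (h : IsMoebius lam F) {p : ℝ × ℝ} (hp : p.2 ∈ Icc (0 : ℝ) 1)
    (v w : ℝ × ℝ) : ⟪dirDeriv v F p, dirDeriv w F p⟫ = v.1 * w.1 + v.2 * w.2 :=
  ContinuousLinearMap.inner_of_norm_eq (h.isom p hp) v w

theorem inner_dirDeriv_dirDeriv (h : IsMoebius lam F) {p : ℝ × ℝ} (hp : p ∈ openStrip)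
    (z v w : ℝ × ℝ) : ⟪dirDeriv z (dirDeriv v F) p, dirDeriv w F p⟫ = 0 := by
  have anti : ∀ z v w : ℝ × ℝ, ⟪dirDeriv z (dirDeriv v F) p, dirDeriv w F p⟫ =
      - ⟪dirDeriv z (dirDeriv w F) p, dirDeriv v F p⟫ := by
    intro z v w
    have := dirDeriv_congr isOpen_openStrip (g := fun q => ⟪dirDeriv v F q, dirDeriv w F q⟫)
      (h := fun _ => v.1 * w.1 + v.2 * w.2)
      (fun q hq => h.inner_dirDeriv ⟨hq.1.le, hq.2.le⟩ v w) z p hp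
    rw [dirDeriv_inner (contDiff_dirDeriv h.smooth v) (contDiff_dirDeriv h.smooth w)] at this
    have h0 : dirDeriv z (fun _ : ℝ × ℝ => v.1 * w.1 + v.2 * w.2) p = 0 := by simp [dirDeriv]
    rw [h0, real_inner_comm] at this
    linarith
  have e1 := anti z v w
  have e2 := anti w z v
  have e3 := anti v w z
  rw [dirDeriv_comm h.smooth z w] at e1
  rw [dirDeriv_comm h.smooth w v] at e2
  rw [dirDeriv_comm h.smooth v z] at e3
  linarith

/-- The Gauss equation. -/
theorem gauss (h : IsMoebius lam F) {p : ℝ × ℝ} (hp : p ∈ openStrip) (e k : ℝ × ℝ) :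
    ⟪dirDeriv e (dirDeriv e F) p, dirDeriv k (dirDeriv k F) p⟫ =
      ⟪dirDeriv e (dirDeriv k F) p, dirDeriv e (dirDeriv k F) p⟫ := by
  have key : ∀ y z v w : ℝ × ℝ, ⟪dirDeriv z (dirDeriv v F) p, dirDeriv y (dirDeriv w F) p⟫ =
      - ⟪dirDeriv y (dirDeriv z (dirDeriv v F)) p, dirDeriv w F p⟫ := by
    intro y z v w
    have := dirDeriv_congr isOpen_openStrip
      (g := fun q => ⟪dirDeriv z (dirDeriv v F) q, dirDeriv w F q⟫) (h := fun _ => (0 : ℝ))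
      (fun q hq => h.inner_dirDeriv_dirDeriv hq z v w) y p hp
    rw [dirDeriv_inner (contDiff_dirDeriv (contDiff_dirDeriv h.smooth v) z)
      (contDiff_dirDeriv h.smooth w)] at this
    have h0 : dirDeriv y (fun _ : ℝ × ℝ => (0 : ℝ)) p = 0 := by simp [dirDeriv]
    rw [h0] at this
    linarith
  have e1 := key k e e k
  have e2 := key e e k k
  rw [e1, e2, dirDeriv_comm (contDiff_dirDeriv h.smooth e) k e, dirDeriv_comm h.smooth k e]

/-- At each point the second fundamental form is a degenerate form times a normal vector. -/
theorem exists_second_form (h : IsMoebius lam F) {p : ℝ × ℝ} (hp : p ∈ openStrip)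
    (e k : ℝ × ℝ) : ∃ (n : Space) (L M N : ℝ), n ≠ 0 ∧
      dirDeriv e (dirDeriv e F) p = L • n ∧ dirDeriv e (dirDeriv k F) p = M • n ∧
      dirDeriv k (dirDeriv k F) p = N • n ∧ L * N = M ^ 2 := by
  have hp' : p.2 ∈ Icc (0 : ℝ) 1 := ⟨hp.1.le, hp.2.le⟩
  obtain ⟨n, hn0, hn⟩ := exists_eq_smul_of_orthogonal
    (a := dirDeriv (1, 0) F p) (b := dirDeriv (0, 1) F p)
    (by rw [h.inner_dirDeriv hp']; norm_num) (by rw [h.inner_dirDeriv hp']; norm_num)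
    (by rw [h.inner_dirDeriv hp']; norm_num)
  have ex : ∀ z v : ℝ × ℝ, ∃ r : ℝ, dirDeriv z (dirDeriv v F) p = r • n := fun z v =>
    hn _ (h.inner_dirDeriv_dirDeriv hp _ _ _) (h.inner_dirDeriv_dirDeriv hp _ _ _)
  obtain ⟨L, hL⟩ := ex e e
  obtain ⟨M, hM⟩ := ex e k
  obtain ⟨N, hN⟩ := ex k k
  refine ⟨n, L, M, N, hn0, hL, hM, hN, ?_⟩
  have hg := h.gauss hp e k
  rw [hL, hM, hN, inner_smul_left, inner_smul_right, inner_smul_left, inner_smul_right] at hg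
  have hnn : ⟪n, n⟫ ≠ 0 := inner_self_ne_zero.2 hn0
  simp only [conj_trivial] at hg
  apply mul_right_cancel₀ hnn
  linarith

/-- The kernel direction of the second fundamental form at a nonflat point persists along the
line it generates, up to the boundary of the strip. -/
theorem kernel_propagates (h : IsMoebius lam F) (e k p : ℝ × ℝ) {T : ℝ} (hT0 : 0 < T)
    (hT : ∀ t ∈ Ico 0 T, p + t • k ∈ openStrip)
    (hM : dirDeriv e (dirDeriv k F) p = 0) (hL : dirDeriv e (dirDeriv e F) p ≠ 0) :
    (∀ t ∈ Ico 0 T, dirDeriv e (dirDeriv e F) (p + t • k) ≠ 0 ∧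
      dirDeriv e (dirDeriv k F) (p + t • k) = 0) ∧ F (p + T • k) = F p + T • dirDeriv k F p := by
  set ν := dirDeriv e (dirDeriv e F) p with hν
  set u : ℝ × ℝ → ℝ := fun q => ⟪F q, ν⟫ with hu
  have su : ContDiff ℝ ∞ u := h.smooth.inner ℝ contDiff_const
  have du : ∀ v w : ℝ × ℝ, ∀ q, dirDeriv v (dirDeriv w u) q = ⟪dirDeriv v (dirDeriv w F) q, ν⟫ := by
    intro v w q
    rw [hu, dirDeriv_inner_const h.smooth, dirDeriv_inner_const (contDiff_dirDeriv h.smooth w)]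
  have main := hessian_kernel_propagates su isOpen_openStrip e k p (fun q hq => by
      obtain ⟨n, L, M, N, -, h1, h2, h3, h4⟩ := h.exists_second_form hq e k
      rw [du, du, du, h1, h2, h3]
      simp only [inner_smul_left, conj_trivial]
      linear_combination ⟪n, ν⟫ ^ 2 * h4) hT0 hT (by rw [du, hM, inner_zero_left])
      (by rw [du, ← hν]; exact inner_self_ne_zero.2 hL)
  have vec : ∀ t ∈ Ico 0 T, dirDeriv e (dirDeriv e F) (p + t • k) ≠ 0 ∧
      dirDeriv e (dirDeriv k F) (p + t • k) = 0 ∧ dirDeriv k (dirDeriv k F) (p + t • k) = 0 := by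
    intro t ht
    obtain ⟨n, L, M, N, hn, h1, h2, h3, h4⟩ := h.exists_second_form (hT t ht) e k
    obtain ⟨m1, m2, m3⟩ := main t ⟨ht.1, ht.2.le⟩
    rw [du, h1, inner_smul_left] at m1
    rw [du, h2, inner_smul_left] at m2
    rw [du, h3, inner_smul_left] at m3
    simp only [conj_trivial] at m1 m2 m3
    have hn' : ⟪n, ν⟫ ≠ 0 := right_ne_zero_of_mul m1
    have hM' : M = 0 := by simpa [hn'] using m2
    have hN' : N = 0 := by simpa [hn'] using m3
    refine ⟨?_, by rw [h2, hM', zero_smul], by rw [h3, hN', zero_smul]⟩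
    rw [h1]
    exact smul_ne_zero (left_ne_zero_of_mul m1) hn
  refine ⟨fun t ht => ⟨(vec t ht).1, (vec t ht).2.1⟩, ?_⟩
  exact eq_add_smul_of_deriv_eq_zero h.smooth hT0 fun t ht => (vec t ⟨ht.1.le, ht.2⟩).2.2

end IsMoebius

/-! ### Bends -/

/-- The squared Euclidean distance in the plane. -/
def sqDist (p q : ℝ × ℝ) : ℝ := (p.1 - q.1) ^ 2 + (p.2 - q.2) ^ 2

/-- The segment from `(a, 0)` to `(b, 1)` is mapped isometrically to a straight segment. -/
def IsBend (F : ℝ × ℝ → Space) (a b : ℝ) : Prop := ‖F (b, 1) - F (a, 0)‖ ^ 2 = 1 + (b - a) ^ 2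

theorem norm_sub_combo_sq {E : Type*} [NormedAddCommGroup E] [InnerProductSpace ℝ E]
    (X P Q R : E) {u v w : ℝ} (hsum : u + v + w = 1) :
    ‖X - (u • P + v • Q + w • R)‖ ^ 2 = u * ‖X - P‖ ^ 2 + v * ‖X - Q‖ ^ 2 + w * ‖X - R‖ ^ 2
      - u * v * ‖P - Q‖ ^ 2 - v * w * ‖Q - R‖ ^ 2 - u * w * ‖P - R‖ ^ 2 := by
  obtain ⟨P', rfl⟩ : ∃ P', P = X - P' := ⟨X - P, by abel⟩
  obtain ⟨Q', rfl⟩ : ∃ Q', Q = X - Q' := ⟨X - Q, by abel⟩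
  obtain ⟨R', rfl⟩ : ∃ R', R = X - R' := ⟨X - R, by abel⟩
  have e1 : X - (u • (X - P') + v • (X - Q') + w • (X - R')) = u • P' + v • Q' + w • R' := by
    have : X = (u + v + w) • X := by rw [hsum, one_smul]
    nth_rewrite 1 [this]
    module
  rw [e1]
  simp only [sub_sub_cancel, sub_sub_sub_cancel_left]
  rw [norm_add_sq_real, norm_add_sq_real, norm_sub_sq_real, norm_sub_sq_real, norm_sub_sq_real,
    inner_add_left]
  simp only [norm_smul, inner_smul_left, inner_smul_right, conj_trivial, mul_pow,
    Real.norm_eq_abs, sq_abs]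
  rw [real_inner_comm P' Q', real_inner_comm Q' R', real_inner_comm P' R']
  obtain rfl : u = 1 - v - w := by linarith
  ring

namespace IsMoebius

variable {lam : ℝ} {F : ℝ × ℝ → Space}

theorem norm_sub_sq_le (h : IsMoebius lam F) {p q : ℝ × ℝ} (hp : p.2 ∈ Icc (0 : ℝ) 1)
    (hq : q.2 ∈ Icc (0 : ℝ) 1) : ‖F p - F q‖ ^ 2 ≤ sqDist p q := by
  have hb := norm_image_sub_le_of_norm_deriv_le_segment_01'
    (f := fun t : ℝ => F (q + t • (p - q))) (f' := fun t => dirDeriv (p - q) F (q + t • (p - q)))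
    (C := Real.sqrt (sqDist p q))
    (fun t _ => (hasDerivAt_comp_line h.smooth q (p - q) t).hasDerivWithinAt)
    (fun t ht => by
      refine le_of_eq (h.isom _ ?_ _)
      simp only [Prod.snd_add, Prod.smul_snd, Prod.snd_sub, smul_eq_mul]
      constructor <;> nlinarith [hp.1, hp.2, hq.1, hq.2, ht.1, ht.2])
  simp only [one_smul, add_sub_cancel, zero_smul, add_zero] at hb
  calc ‖F p - F q‖ ^ 2 ≤ Real.sqrt (sqDist p q) ^ 2 := by gcongr
    _ = sqDist p q := Real.sq_sqrt (by unfold sqDist; positivity)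

theorem norm_sub_combo_sq_le (h : IsMoebius lam F) {p q r : ℝ × ℝ}
    (hp : p.2 ∈ Icc (0 : ℝ) 1) (hq : q.2 ∈ Icc (0 : ℝ) 1) (hr : r.2 ∈ Icc (0 : ℝ) 1)
    {u v w : ℝ} (hu : 0 ≤ u) (hv : 0 ≤ v) (hw : 0 ≤ w) (hsum : u + v + w = 1) :
    ‖F (u • p + v • q + w • r) - (u • F p + v • F q + w • F r)‖ ^ 2 ≤
      u * v * (sqDist p q - ‖F p - F q‖ ^ 2) + v * w * (sqDist q r - ‖F q - F r‖ ^ 2)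
      + u * w * (sqDist p r - ‖F p - F r‖ ^ 2) := by
  have hs : (u • p + v • q + w • r).2 ∈ Icc (0 : ℝ) 1 := by
    simp only [Prod.snd_add, Prod.smul_snd, smul_eq_mul]
    constructor
    · have := mul_nonneg hu hp.1
      have := mul_nonneg hv hq.1
      have := mul_nonneg hw hr.1
      linarith
    · have := mul_le_mul_of_nonneg_left hp.2 hu
      have := mul_le_mul_of_nonneg_left hq.2 hv
      have := mul_le_mul_of_nonneg_left hr.2 hw
      linarith
  rw [norm_sub_combo_sq _ _ _ _ hsum]
  have h1 := mul_le_mul_of_nonneg_left (h.norm_sub_sq_le hs hp) hu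
  have h2 := mul_le_mul_of_nonneg_left (h.norm_sub_sq_le hs hq) hv
  have h3 := mul_le_mul_of_nonneg_left (h.norm_sub_sq_le hs hr) hw
  have flat : u * sqDist (u • p + v • q + w • r) p + v * sqDist (u • p + v • q + w • r) q
      + w * sqDist (u • p + v • q + w • r) r
      = u * v * sqDist p q + v * w * sqDist q r + u * w * sqDist p r := by
    simp only [sqDist, Prod.snd_add, Prod.smul_snd, smul_eq_mul, Prod.fst_add, Prod.smul_fst]
    obtain rfl : u = 1 - v - w := by linarith
    ring
  linarith

theorem add_two_mul (h : IsMoebius lam F) (x : ℝ) {y : ℝ} (hy : y ∈ Icc (0 : ℝ) 1) :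
    F (x + 2 * lam, y) = F (x, y) := by
  have h1 := h.glue (x + lam) (1 - y) ⟨by linarith [hy.2], by linarith [hy.1]⟩
  rw [sub_sub_cancel, h.glue x y hy] at h1
  rw [← h1]
  congr 2
  ring

theorem add_int_mul (h : IsMoebius lam F) (n : ℤ) (x : ℝ) {y : ℝ} (hy : y ∈ Icc (0 : ℝ) 1) :
    F (x + n * (2 * lam), y) = F (x, y) := by
  have hper : Function.Periodic (fun x => F (x, y)) (2 * lam) := fun x => h.add_two_mul x hy
  exact hper.int_mul n x

theorem isBend_glue (h : IsMoebius lam F) {a b : ℝ} (hab : IsBend F a b) :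
    IsBend F (b + lam) (a + lam) := by
  have h1 := h.glue a 0 (by simp)
  have h2 := h.glue b 1 (by simp)
  rw [sub_zero] at h1
  rw [sub_self] at h2
  unfold IsBend at *
  rw [h1, h2, norm_sub_rev, hab]
  ring

/-- A convex combination of points with isometric pairwise distances. -/
theorem apply_segment (h : IsMoebius lam F) {p q : ℝ × ℝ}
    (hp : p.2 ∈ Icc (0 : ℝ) 1) (hq : q.2 ∈ Icc (0 : ℝ) 1)
    (hpq : ‖F p - F q‖ ^ 2 = sqDist p q) {t : ℝ} (ht : t ∈ Icc (0 : ℝ) 1) :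
    F ((1 - t) • p + t • q) = (1 - t) • F p + t • F q := by
  have h1 := h.norm_sub_combo_sq_le hp hq hq (u := 1 - t) (v := t) (w := 0)
    (by linarith [ht.2]) ht.1 le_rfl (by ring)
  simp only [hpq, zero_smul, add_zero, sub_self, mul_zero, zero_mul] at h1
  have h2 := le_antisymm h1 (sq_nonneg _)
  rw [sq_eq_zero_iff, norm_eq_zero, sub_eq_zero] at h2
  exact h2

theorem apply_bend (h : IsMoebius lam F) {a b : ℝ} (hab : IsBend F a b) {y : ℝ}
    (hy : y ∈ Icc (0 : ℝ) 1) :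
    F ((1 - y) * a + y * b, y) = F (a, 0) + y • (F (b, 1) - F (a, 0)) := by
  have := h.apply_segment (p := (a, 0)) (q := (b, 1)) (by simp) (by simp)
    (by rw [norm_sub_rev]; unfold IsBend at hab; rw [hab]; simp [sqDist]; ring) hy
  simp only [Prod.smul_mk, smul_eq_mul, Prod.mk_add_mk, mul_zero, zero_add, mul_one] at this
  rw [this]
  module

theorem dirDeriv_bend (h : IsMoebius lam F) {a b : ℝ} (hab : IsBend F a b) {y : ℝ}
    (hy : y ∈ Icc (0 : ℝ) 1) :
    dirDeriv (b - a, 1) F ((1 - y) * a + y * b, y) = F (b, 1) - F (a, 0) := by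
  have key : ∀ t : ℝ, ((a, 0) : ℝ × ℝ) + t • ((b - a, 1) : ℝ × ℝ) = ((1 - t) * a + t * b, t) := by
    intro t
    ext <;> simp
    ring
  have h1 := (hasDerivAt_comp_line h.smooth (a, 0) (b - a, 1) y).hasDerivWithinAt (s := Icc 0 1)
  simp only [key] at h1
  have h2 : HasDerivWithinAt (fun t : ℝ => F ((1 - t) * a + t * b, t)) (F (b, 1) - F (a, 0))
      (Icc 0 1) y := by
    have h3 : HasDerivWithinAt (fun t : ℝ => F (a, 0) + t • (F (b, 1) - F (a, 0)))
        (F (b, 1) - F (a, 0)) (Icc 0 1) y := by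
      have := (((hasDerivAt_id y).smul_const (F (b, 1) - F (a, 0))).const_add
        (F (a, 0))).hasDerivWithinAt (s := Icc 0 1)
      exact this.congr_deriv (by simp)
    exact h3.congr (fun t ht => h.apply_bend hab ht) (h.apply_bend hab hy)
  exact (uniqueDiffOn_Icc zero_lt_one y hy).eq_deriv _ h1 h2

/-- Crossing bends span a region on which the map is an affine isometry. -/
theorem isBend_of_crossing (h : IsMoebius lam F) {a b a' b' c d : ℝ} (hab : IsBend F a b)
    (hab' : IsBend F a' b') (hc : c ∈ Icc a a') (hd : d ∈ Icc b' b) : IsBend F c d := by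
  obtain ⟨y, hy, hX⟩ : ∃ y ∈ Icc (0 : ℝ) 1, (1 - y) * a + y * b = (1 - y) * a' + y * b' := by
    have ha : a ≤ a' := hc.1.trans hc.2
    have hb : b' ≤ b := hd.1.trans hd.2
    rcases ha.eq_or_lt with h0 | h0
    · exact ⟨0, by simp, by simp [h0]⟩
    · have hpos : 0 < (a' - a) + (b - b') := by linarith
      refine ⟨(a' - a) / ((a' - a) + (b - b')), ⟨?_, ?_⟩, ?_⟩
      · exact div_nonneg (by linarith) hpos.le
      · rw [div_le_one hpos]; linarith
      · field_simp
        ring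
  set x := (1 - y) * a + y * b with hx
  set Φ := fderiv ℝ F (x, y) with hΦ
  have hΦn : ∀ v : ℝ × ℝ, ‖Φ v‖ ^ 2 = v.1 ^ 2 + v.2 ^ 2 := fun v => by
    rw [hΦ, h.isom (x, y) hy v, Real.sq_sqrt (by positivity)]
  have e1 : Φ (b - a, 1) = F (b, 1) - F (a, 0) := h.dirDeriv_bend hab hy
  have e2 : Φ (b' - a', 1) = F (b', 1) - F (a', 0) := by
    have := h.dirDeriv_bend hab' hy
    rw [← hX] at this
    exact this
  have q1 := h.apply_bend hab hy
  have q2 := h.apply_bend hab' hy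
  rw [← hX] at q2
  rw [← hx] at q1
  have fa : F (a, 0) = F (x, y) + Φ ((a, 0) - (x, y)) := by
    have : ((a, 0) : ℝ × ℝ) - (x, y) = (-y) • ((b - a, 1) : ℝ × ℝ) := by
      ext <;> simp [hx]; ring
    rw [this, map_smul, e1, q1]
    module
  have fb : F (b, 1) = F (x, y) + Φ ((b, 1) - (x, y)) := by
    have : ((b, 1) : ℝ × ℝ) - (x, y) = (1 - y) • ((b - a, 1) : ℝ × ℝ) := by
      ext <;> simp [hx]; ring
    rw [this, map_smul, e1, q1]
    module
  have fa' : F (a', 0) = F (x, y) + Φ ((a', 0) - (x, y)) := by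
    have : ((a', 0) : ℝ × ℝ) - (x, y) = (-y) • ((b' - a', 1) : ℝ × ℝ) := by
      ext <;> simp [hX]; ring
    rw [this, map_smul, e2, q2]
    module
  have fb' : F (b', 1) = F (x, y) + Φ ((b', 1) - (x, y)) := by
    have : ((b', 1) : ℝ × ℝ) - (x, y) = (1 - y) • ((b' - a', 1) : ℝ × ℝ) := by
      ext <;> simp [hX]; ring
    rw [this, map_smul, e2, q2]
    module
  have seg : ∀ p q : ℝ × ℝ, p.2 ∈ Icc (0 : ℝ) 1 → q.2 ∈ Icc (0 : ℝ) 1 →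
      F p = F (x, y) + Φ (p - (x, y)) → F q = F (x, y) + Φ (q - (x, y)) → ∀ t ∈ Icc (0 : ℝ) 1,
      F ((1 - t) • p + t • q) = F (x, y) + Φ ((1 - t) • p + t • q - (x, y)) := by
    intro p q hp hq fp fq t ht
    have hpq : ‖F p - F q‖ ^ 2 = sqDist p q := by
      rw [fp, fq, add_sub_add_left_eq_sub, ← map_sub, hΦn]
      simp [sqDist]
    rw [h.apply_segment hp hq hpq ht, fp, fq]
    have : (1 - t) • p + t • q - (x, y) = (1 - t) • (p - (x, y)) + t • (q - (x, y)) := by module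
    rw [this, map_add, map_smul, map_smul]
    module
  have comb : ∀ {l r m : ℝ}, m ∈ Icc l r → ∃ t ∈ Icc (0 : ℝ) 1, m = (1 - t) * l + t * r := by
    intro l r m hm
    have hm' : m ∈ segment ℝ l r := by rwa [segment_eq_Icc (hm.1.trans hm.2)]
    rw [segment_eq_image] at hm'
    obtain ⟨t, ht, rfl⟩ := hm'
    exact ⟨t, ht, by simp⟩
  have fc : F (c, 0) = F (x, y) + Φ ((c, 0) - (x, y)) := by
    obtain ⟨t, ht, rfl⟩ := comb hc
    have := seg (a, 0) (a', 0) (by simp) (by simp) fa fa' t ht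
    simpa using this
  have fd : F (d, 1) = F (x, y) + Φ ((d, 1) - (x, y)) := by
    obtain ⟨t, ht, rfl⟩ := comb hd
    have := seg (b', 1) (b, 1) (by simp) (by simp) fb' fb t ht
    simpa using this
  unfold IsBend
  rw [fc, fd, add_sub_add_left_eq_sub, ← map_sub, hΦn]
  simp
  ring

end IsMoebius

/-! ### Bends through nonflat points -/

/-- Vanishing of the second derivative in the long direction. -/
def IsFlatAt (F : ℝ × ℝ → Space) (p : ℝ × ℝ) : Prop := dirDeriv (1, 0) (dirDeriv (1, 0) F) p = 0

theorem dirDeriv_dirDeriv_eq {F : ℝ × ℝ → Space} (hF : ContDiff ℝ ∞ F) (p v w : ℝ × ℝ) :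
    dirDeriv v (dirDeriv w F) p = (v.1 * w.1) • dirDeriv (1, 0) (dirDeriv (1, 0) F) p
      + (v.1 * w.2 + v.2 * w.1) • dirDeriv (1, 0) (dirDeriv (0, 1) F) p
      + (v.2 * w.2) • dirDeriv (0, 1) (dirDeriv (0, 1) F) p := by
  have split : ∀ v : ℝ × ℝ, v = v.1 • ((1, 0) : ℝ × ℝ) + v.2 • ((0, 1) : ℝ × ℝ) := by
    intro v
    ext <;> simp
  have first : ∀ {g : ℝ × ℝ → Space} (v : ℝ × ℝ), dirDeriv v g =
      fun q => v.1 • dirDeriv (1, 0) g q + v.2 • dirDeriv (0, 1) g q := by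
    intro g v
    funext q
    conv_lhs => rw [split v]
    rw [dirDeriv_add_left, dirDeriv_smul_left, dirDeriv_smul_left]
  have s1 := contDiff_dirDeriv hF (1, 0)
  have s2 := contDiff_dirDeriv hF (0, 1)
  have second : ∀ z : ℝ × ℝ, dirDeriv z (dirDeriv w F) p =
      w.1 • dirDeriv z (dirDeriv (1, 0) F) p + w.2 • dirDeriv z (dirDeriv (0, 1) F) p := by
    intro z
    rw [first (g := F) w, dirDeriv_fun_add (g := fun q => w.1 • dirDeriv (1, 0) F q)
      (h := fun q => w.2 • dirDeriv (0, 1) F q) (s1.const_smul w.1) (s2.const_smul w.2),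
      dirDeriv_fun_smul s1, dirDeriv_fun_smul s2]
  rw [first (g := dirDeriv w F) v]
  simp only [second]
  rw [dirDeriv_comm hF (0, 1) (1, 0)]
  module

namespace IsMoebius

variable {lam : ℝ} {F : ℝ × ℝ → Space}

theorem dirDeriv_dirDeriv_eq_zero_of_isFlatAt (h : IsMoebius lam F) {p : ℝ × ℝ}
    (hp : p ∈ openStrip) (hflat : IsFlatAt F p) (v w : ℝ × ℝ) :
    dirDeriv v (dirDeriv w F) p = 0 := by
  have hp' : p.2 ∈ Icc (0 : ℝ) 1 := ⟨hp.1.le, hp.2.le⟩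
  obtain ⟨n, L, M, N, hn, h1, h2, h3, h4⟩ := h.exists_second_form hp (1, 0) (0, 1)
  have hL : L = 0 := by
    have : L • n = 0 := h1 ▸ hflat
    simpa [hn] using this
  have hM : M = 0 := by
    rw [hL, zero_mul] at h4
    exact pow_eq_zero_iff two_ne_zero |>.1 h4.symm
  rw [hM, zero_smul] at h2
  have h22 : dirDeriv (0, 1) (dirDeriv (0, 1) F) p = 0 := by
    by_contra hne
    have hk := (h.kernel_propagates (0, 1) (1, 0) p (T := 2 * lam) (by linarith [h.pos])
      (fun t _ => by simpa [openStrip] using hp) (by rw [dirDeriv_comm h.smooth, h2]) hne).2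
    have hper : F (p + (2 * lam) • ((1, 0) : ℝ × ℝ)) = F p := by
      have := h.add_two_mul p.1 hp'
      rw [← this]
      congr 1
      ext <;> simp
    rw [hper, left_eq_add, smul_eq_zero] at hk
    have hz := hk.resolve_left (by linarith [h.pos])
    have := h.inner_dirDeriv hp' (1, 0) (1, 0)
    rw [hz, inner_zero_left] at this
    norm_num at this
  rw [dirDeriv_dirDeriv_eq h.smooth, hflat, h2, h22]
  simp

theorem isBend_of_isFlatAt (h : IsMoebius lam F) {a b : ℝ}
    (hflat : ∀ y ∈ Ioo (0 : ℝ) 1, IsFlatAt F ((1 - y) * a + y * b, y)) : IsBend F a b := by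
  have key : ∀ t : ℝ, ((a, 0) : ℝ × ℝ) + t • ((b - a, 1) : ℝ × ℝ) = ((1 - t) * a + t * b, t) := by
    intro t
    ext <;> simp
    ring
  have := eq_add_smul_of_deriv_eq_zero h.smooth (p := (a, 0)) (k := (b - a, 1)) zero_lt_one
    (fun t ht => by
      rw [key]
      exact h.dirDeriv_dirDeriv_eq_zero_of_isFlatAt ht (hflat t ht) _ _)
  rw [key] at this
  unfold IsBend
  have e : ((1 - 1) * a + 1 * b, (1 : ℝ)) = (b, 1) := by ext <;> simp
  rw [e, one_smul] at this
  rw [this, add_sub_cancel_left, ← real_inner_self_eq_norm_sq, h.inner_dirDeriv (by simp)]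
  ring

theorem exists_isBend_of_not_isFlatAt (h : IsMoebius lam F) {x y : ℝ} (hy : y ∈ Ioo (0 : ℝ) 1)
    (hne : ¬ IsFlatAt F (x, y)) : ∃ a b : ℝ, IsBend F a b ∧ (1 - y) * a + y * b = x ∧
      ∀ t ∈ Ioo (0 : ℝ) 1, ¬ IsFlatAt F ((1 - t) * a + t * b, t) := by
  obtain ⟨n, L, M, N, hn, h1, h2, h3, h4⟩ :=
    h.exists_second_form (p := (x, y)) hy (1, 0) (0, 1)
  have hL : L ≠ 0 := by
    rintro rfl
    exact hne (by unfold IsFlatAt; rw [h1, zero_smul])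
  set m : ℝ := - M / L with hm
  have hk0 : dirDeriv (1, 0) (dirDeriv (m, 1) F) (x, y) = 0 := by
    rw [dirDeriv_dirDeriv_eq h.smooth, h1, h2, smul_smul, smul_smul]
    simp only [mul_one, one_mul, zero_mul, add_zero, zero_smul, ← add_smul]
    rw [hm, div_mul_cancel₀ _ hL, neg_add_cancel, zero_smul]
  have hk0' : dirDeriv (1, 0) (dirDeriv (-m, -1) F) (x, y) = 0 := by
    rw [dirDeriv_dirDeriv_eq h.smooth] at hk0 ⊢
    rw [← neg_eq_zero, ← hk0]
    simp
    abel
  obtain ⟨f1, f2⟩ := h.kernel_propagates (1, 0) (m, 1) (x, y) (T := 1 - y) (by linarith [hy.2])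
    (fun t ht => by
      simp only [openStrip, mem_ofPred_eq, Prod.snd_add, Prod.smul_snd, smul_eq_mul, mul_one]
      exact ⟨by linarith [ht.1, hy.1], by linarith [ht.2]⟩) hk0 hne
  obtain ⟨g1, g2⟩ := h.kernel_propagates (1, 0) (-m, -1) (x, y) (T := y) hy.1
    (fun t ht => by
      simp only [openStrip, mem_ofPred_eq, Prod.snd_add, Prod.smul_snd, smul_eq_mul, mul_neg,
        mul_one]
      exact ⟨by linarith [ht.2], by linarith [ht.1, hy.2]⟩) hk0' hne
  refine ⟨x - y * m, x + (1 - y) * m, ?_, by ring, ?_⟩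
  · have e1 : ((x, y) : ℝ × ℝ) + (1 - y) • ((m, 1) : ℝ × ℝ) = (x + (1 - y) * m, 1) := by
      ext <;> simp
    have e2 : ((x, y) : ℝ × ℝ) + y • ((-m, -1) : ℝ × ℝ) = (x - y * m, 0) := by
      ext <;> simp
      ring
    rw [e1] at f2
    rw [e2] at g2
    have e3 : dirDeriv (-m, -1) F (x, y) = - dirDeriv (m, 1) F (x, y) := by
      have := dirDeriv_smul_left F (-1) (m, 1) (x, y)
      simpa using this
    have e4 : F (x + (1 - y) * m, 1) - F (x - y * m, 0) = dirDeriv (m, 1) F (x, y) := by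
      rw [f2, g2, e3]
      module
    unfold IsBend
    rw [e4, ← real_inner_self_eq_norm_sq, h.inner_dirDeriv ⟨hy.1.le, hy.2.le⟩]
    ring
  · intro t ht
    rcases le_total y t with hyt | hyt
    · have := (f1 (t - y) ⟨by linarith, by linarith [ht.2]⟩).1
      rw [show ((x, y) : ℝ × ℝ) + (t - y) • ((m, 1) : ℝ × ℝ)
        = ((1 - t) * (x - y * m) + t * (x + (1 - y) * m), t) by ext <;> simp; ring] at this
      exact this
    · have := (g1 (y - t) ⟨by linarith, by linarith [ht.1]⟩).1
      rw [show ((x, y) : ℝ × ℝ) + (y - t) • ((-m, -1) : ℝ × ℝ)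
        = ((1 - t) * (x - y * m) + t * (x + (1 - y) * m), t) by ext <;> simp; ring] at this
      exact this

theorem dirDeriv_dirDeriv_bend (h : IsMoebius lam F) {a b : ℝ} (hab : IsBend F a b) {y : ℝ}
    (hy : y ∈ Ioo (0 : ℝ) 1) :
    dirDeriv (b - a, 1) (dirDeriv (b - a, 1) F) ((1 - y) * a + y * b, y) = 0 := by
  have key : ∀ t : ℝ, ((a, 0) : ℝ × ℝ) + t • ((b - a, 1) : ℝ × ℝ) = ((1 - t) * a + t * b, t) := by
    intro t
    ext <;> simp
    ring
  have h1 := hasDerivAt_comp_line (contDiff_dirDeriv h.smooth (b - a, 1)) (a, 0) (b - a, 1) y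
  simp only [key] at h1
  have h2 : HasDerivAt (fun t : ℝ => dirDeriv (b - a, 1) F ((1 - t) * a + t * b, t)) 0 y := by
    refine (hasDerivAt_const y (F (b, 1) - F (a, 0))).congr_of_eventuallyEq ?_
    filter_upwards [Ioo_mem_nhds hy.1 hy.2] with t ht using h.dirDeriv_bend hab ⟨ht.1.le, ht.2.le⟩
  exact h1.unique h2

/-- At most one bend passes through a nonflat point. -/
theorem bend_unique (h : IsMoebius lam F) {a b a' b' : ℝ} (hab : IsBend F a b)
    (hab' : IsBend F a' b') {y : ℝ} (hy : y ∈ Ioo (0 : ℝ) 1)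
    (hX : (1 - y) * a + y * b = (1 - y) * a' + y * b')
    (hne : ¬ IsFlatAt F ((1 - y) * a + y * b, y)) : a = a' ∧ b = b' := by
  obtain ⟨n, L, M, N, hn, h1, h2, h3, h4⟩ :=
    h.exists_second_form (p := ((1 - y) * a + y * b, y)) hy (1, 0) (0, 1)
  have hL : L ≠ 0 := by
    rintro rfl
    exact hne (by unfold IsFlatAt; rw [h1, zero_smul])
  have slope : ∀ {c d : ℝ}, IsBend F c d → (1 - y) * a + y * b = (1 - y) * c + y * d →
      L * (d - c) + M = 0 := by
    intro c d hcd hx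
    have := h.dirDeriv_dirDeriv_bend hcd hy
    rw [← hx, dirDeriv_dirDeriv_eq h.smooth, h1, h2, h3, smul_smul, smul_smul, smul_smul,
      ← add_smul, ← add_smul, smul_eq_zero] at this
    have := this.resolve_right hn
    have : (L * (d - c) + M) ^ 2 = 0 := by linear_combination L * this - h4
    exact pow_eq_zero_iff two_ne_zero |>.1 this
  have hs : b - a = b' - a' := by
    have := slope hab rfl
    have := slope hab' hX
    exact mul_left_cancel₀ hL (by linarith)
  exact ⟨by linear_combination hX - y * hs, by linear_combination hX + (1 - y) * hs⟩

end IsMoebius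

/-! ### A continuous family of bends -/

namespace IsMoebius

variable {lam : ℝ} {F : ℝ × ℝ → Space}

theorem isBend_add_int_mul (h : IsMoebius lam F) {a b : ℝ} (hab : IsBend F a b) (n : ℤ) :
    IsBend F (a + n * (2 * lam)) (b + n * (2 * lam)) := by
  unfold IsBend at *
  rw [h.add_int_mul n a (by simp), h.add_int_mul n b (by simp), hab]
  ring

theorem abs_sub_le_of_isBend (h : IsMoebius lam F) {a b : ℝ} (hab : IsBend F a b) :
    |b - a| ≤ 2 * lam := by
  obtain ⟨n, hn, -⟩ := existsUnique_add_zsmul_mem_Ico (a := 2 * lam) (by linarith [h.pos]) b a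
  have h1 := h.norm_sub_sq_le (p := (b + n * (2 * lam), 1)) (q := (a, 0)) (by simp) (by simp)
  rw [h.add_int_mul n b (by simp)] at h1
  unfold IsBend at hab
  rw [hab] at h1
  simp only [zsmul_eq_mul] at hn
  simp only [sqDist] at h1
  refine abs_le_of_sq_le_sq ?_ (by linarith [h.pos])
  have : (b + n * (2 * lam) - a) ^ 2 ≤ (2 * lam) ^ 2 :=
    pow_le_pow_left₀ (by linarith [hn.1]) (by linarith [hn.2]) 2
  linarith

/-- A bend with nonflat interior coincides with any bend that it meets. -/
theorem eq_of_meets (h : IsMoebius lam F) {a b a' b' : ℝ} (hab : IsBend F a b)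
    (hab' : IsBend F a' b')
    (hne : ∀ t ∈ Ioo (0 : ℝ) 1, ¬ IsFlatAt F ((1 - t) * a + t * b, t)) {y : ℝ}
    (hy : y ∈ Ioo (0 : ℝ) 1)
    (hs : ((1 - y) * a + y * b - ((1 - y) * a' + y * b')) * (a + b - (a' + b')) ≤ 0) :
    a = a' ∧ b = b' := by
  set g : ℝ → ℝ := fun t => (1 - t) * (a - a') + t * (b - b') with hg
  have hgc : Continuous g := by fun_prop
  have h1 : g (1 / 2) = (a + b - (a' + b')) / 2 := by simp only [hg]; ring
  have h2 : g y = (1 - y) * a + y * b - ((1 - y) * a' + y * b') := by simp only [hg]; ring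
  have h3 : (0 : ℝ) ∈ uIcc (g y) (g (1 / 2)) := by
    rw [h1, h2, mem_uIcc]
    rcases mul_nonpos_iff.1 hs with h4 | h4
    · exact Or.inr ⟨by linarith [h4.2], h4.1⟩
    · exact Or.inl ⟨h4.1, by linarith [h4.2]⟩
  obtain ⟨t, ht, ht0⟩ := intermediate_value_uIcc hgc.continuousOn h3
  have ht' : t ∈ Ioo (0 : ℝ) 1 := by
    rcases mem_uIcc.1 ht with h4 | h4
    · exact ⟨by linarith [hy.1], by linarith⟩
    · exact ⟨by linarith, by linarith [hy.2]⟩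
  exact h.bend_unique hab hab' ht' (by simp only [hg] at ht0; linarith) (hne t ht')

theorem exists_isBend (h : IsMoebius lam F) : ∃ a b : ℝ, IsBend F a b := by
  by_cases hf : ∀ y ∈ Ioo (0 : ℝ) 1, IsFlatAt F ((1 - y) * 0 + y * 0, y)
  · exact ⟨0, 0, h.isBend_of_isFlatAt hf⟩
  · push Not at hf
    obtain ⟨y, hy, hne⟩ := hf
    obtain ⟨a, b, hab, -⟩ := h.exists_isBend_of_not_isFlatAt hy hne
    exact ⟨a, b, hab⟩

theorem isClosed_setOf_isBend (h : IsMoebius lam F) :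
    IsClosed {p : ℝ × ℝ | IsBend F ((p.1 - p.2) / 2) ((p.1 + p.2) / 2)} := by
  have := h.smooth.continuous
  unfold IsBend
  exact isClosed_eq (by fun_prop) (by fun_prop)

theorem isCompact_bends (h : IsMoebius lam F) (s t : ℝ) :
    IsCompact ({p : ℝ × ℝ | IsBend F ((p.1 - p.2) / 2) ((p.1 + p.2) / 2)} ∩
      (Icc s t ×ˢ univ)) := by
  refine ((isCompact_Icc (a := s) (b := t)).prod
    (isCompact_Icc (a := -(2 * lam)) (b := 2 * lam))).of_isClosed_subset
    (h.isClosed_setOf_isBend.inter (isClosed_Icc.prod isClosed_univ)) ?_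
  rintro ⟨x, d⟩ ⟨h1, h2⟩
  refine ⟨h2.1, abs_le.1 ?_⟩
  have := h.abs_sub_le_of_isBend h1
  rwa [show (x + d) / 2 - (x - d) / 2 = d by ring] at this

theorem nonempty_bends (h : IsMoebius lam F) (s : ℝ) :
    ({p : ℝ × ℝ | IsBend F ((p.1 - p.2) / 2) ((p.1 + p.2) / 2)} ∩
      (Icc s (s + 4 * lam) ×ˢ univ)).Nonempty := by
  obtain ⟨a, b, hab⟩ := h.exists_isBend
  obtain ⟨n, hn, -⟩ :=
    existsUnique_add_zsmul_mem_Ico (a := 4 * lam) (by linarith [h.pos]) (a + b) s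
  simp only [zsmul_eq_mul] at hn
  refine ⟨(a + b + n * (4 * lam), b - a), ?_, ⟨⟨hn.1, hn.2.le⟩, trivial⟩⟩
  have := h.isBend_add_int_mul hab n
  simp only [mem_ofPred_eq]
  convert this using 1 <;> ring

theorem exists_isBend_add_eq (h : IsMoebius lam F) (s : ℝ) :
    ∃ d, IsBend F ((s - d) / 2) ((s + d) / 2) := by
  by_contra! hno
  have hno' : ∀ a b : ℝ, IsBend F a b → a + b ≠ s := by
    rintro a b hab rfl
    refine hno (b - a) ?_
    convert hab using 1 <;> ring
  obtain ⟨⟨s₁, d₁⟩, ⟨hbend₁, hs₁, -⟩, hmax⟩ := (h.isCompact_bends (s - 4 * lam) s).exists_isMaxOn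
    (by simpa using h.nonempty_bends (s - 4 * lam)) continuous_fst.continuousOn
  obtain ⟨⟨s₂, d₂⟩, ⟨hbend₂, hs₂, -⟩, hmin⟩ := (h.isCompact_bends s (s + 4 * lam)).exists_isMinOn
    (h.nonempty_bends s) continuous_fst.continuousOn
  simp only [mem_ofPred_eq] at hbend₁ hbend₂ hs₁ hs₂
  have max' : ∀ a b : ℝ, IsBend F a b → a + b ≤ s → a + b ≤ s₁ := by
    intro a b hab hle
    by_cases hlow : s - 4 * lam ≤ a + b
    · refine hmax (a := (a + b, b - a)) ⟨?_, ⟨hlow, hle⟩, trivial⟩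
      simp only [mem_ofPred_eq]
      convert hab using 1 <;> ring
    · linarith [hs₁.1]
  have min' : ∀ a b : ℝ, IsBend F a b → s ≤ a + b → s₂ ≤ a + b := by
    intro a b hab hle
    by_cases hlow : a + b ≤ s + 4 * lam
    · refine hmin (a := (a + b, b - a)) ⟨?_, ⟨hle, hlow⟩, trivial⟩
      simp only [mem_ofPred_eq]
      convert hab using 1 <;> ring
    · linarith [hs₂.2]
  obtain ⟨a₁, b₁, rfl, hb₁⟩ : ∃ a b : ℝ, s₁ = a + b ∧ IsBend F a b :=
    ⟨_, _, by ring, hbend₁⟩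
  obtain ⟨a₂, b₂, rfl, hb₂⟩ : ∃ a b : ℝ, s₂ = a + b ∧ IsBend F a b :=
    ⟨_, _, by ring, hbend₂⟩
  have lt₁ : a₁ + b₁ < s := lt_of_le_of_ne hs₁.2 (hno' _ _ hb₁)
  have lt₂ : s < a₂ + b₂ := lt_of_le_of_ne hs₂.1 (hno' _ _ hb₂).symm
  obtain ⟨θ, hθ0, hθ1, hθ⟩ : ∃ θ : ℝ, 0 ≤ θ ∧ θ ≤ 1 ∧
      (1 - θ) * (a₁ + b₁) + θ * (a₂ + b₂) = s := by
    refine ⟨(s - (a₁ + b₁)) / (a₂ + b₂ - (a₁ + b₁)), ?_, ?_, ?_⟩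
    · exact div_nonneg (by linarith) (by linarith)
    · rw [div_le_one (by linarith)]; linarith
    · have : a₂ + b₂ - (a₁ + b₁) ≠ 0 := by linarith
      field_simp
      ring
  set c := (1 - θ) * a₁ + θ * a₂ with hc
  set e := (1 - θ) * b₁ + θ * b₂ with he
  have hce : c + e = s := by rw [← hθ]; ring
  refine hno' c e ?_ hce
  rcases lt_or_ge a₂ a₁ with ha | ha
  · exact h.isBend_of_crossing hb₂ hb₁ ⟨by nlinarith, by nlinarith⟩ ⟨by nlinarith, by nlinarith⟩
  rcases lt_or_ge b₂ b₁ with hb | hb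
  · exact h.isBend_of_crossing hb₁ hb₂ ⟨by nlinarith, by nlinarith⟩ ⟨by nlinarith, by nlinarith⟩
  have c₁ : a₁ ≤ c := by nlinarith
  have c₂ : c ≤ a₂ := by nlinarith
  have e₁ : b₁ ≤ e := by nlinarith
  have e₂ : e ≤ b₂ := by nlinarith
  by_contra hnb
  refine hnb (h.isBend_of_isFlatAt fun y hy => ?_)
  by_contra hne
  obtain ⟨a', b', hb', hX, hne'⟩ := h.exists_isBend_of_not_isFlatAt hy hne
  have y0 := hy.1
  have y1 : 0 < 1 - y := by linarith [hy.2]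
  rcases le_total (a' + b') s with hle | hle
  · have hm := max' a' b' hb' hle
    obtain ⟨rfl, rfl⟩ := h.eq_of_meets hb' hb₁ hne' hy
      (mul_nonpos_of_nonneg_of_nonpos (by rw [hX]; nlinarith) (by linarith))
    have q1 : c = a' := by nlinarith
    have q2 : e = b' := by nlinarith
    exact hnb (by rw [q1, q2]; exact hb')
  · have hm := min' a' b' hb' hle
    obtain ⟨rfl, rfl⟩ := h.eq_of_meets hb' hb₂ hne' hy
      (mul_nonpos_of_nonpos_of_nonneg (by rw [hX]; nlinarith) (by linarith))
    have q1 : c = a' := by nlinarith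
    have q2 : e = b' := by nlinarith
    exact hnb (by rw [q1, q2]; exact hb')

/-- A Lipschitz selection of bends that respects the Moebius identification. -/
theorem exists_bend_family (h : IsMoebius lam F) : ∃ m : ℝ → ℝ,
    (∀ s, IsBend F ((s - m s) / 2) ((s + m s) / 2)) ∧ (∀ s, m (s + 2 * lam) = - m s) ∧
    ∀ s s', |m s - m s'| ≤ |s - s'| := by
  set D : ℝ → Set ℝ := fun s => {d | IsBend F ((s - d) / 2) ((s + d) / 2)} with hD
  have Dne : ∀ s, (D s).Nonempty := fun s => h.exists_isBend_add_eq s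
  have Dbd : ∀ s, BddAbove (D s) := fun s => ⟨2 * lam, fun d hd => by
    have := (le_abs_self _).trans (h.abs_sub_le_of_isBend hd)
    linarith⟩
  have Dcl : ∀ s, IsClosed (D s) := fun s =>
    h.isClosed_setOf_isBend.preimage (Continuous.prodMk_right s)
  set P : ℝ → ℝ := fun s => sSup (D s) with hP
  have Pmem : ∀ s, P s ∈ D s := fun s => (Dcl s).csSup_mem (Dne s) (Dbd s)
  have Pge : ∀ a b : ℝ, IsBend F a b → b - a ≤ P (a + b) := fun a b hab =>
    le_csSup (Dbd _) (by simp only [hD, mem_ofPred_eq]; convert hab using 1 <;> ring)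
  have Dglue : ∀ s d, d ∈ D s → -d ∈ D (s + 2 * lam) := by
    intro s d hd
    have := h.isBend_glue hd
    simp only [hD, mem_ofPred_eq]
    convert this using 1 <;> ring
  have Dper : ∀ s, D (s + 2 * lam + 2 * lam) = D s := by
    intro s
    ext d
    constructor
    · intro hd
      have := h.isBend_add_int_mul hd (-1)
      simp only [hD, mem_ofPred_eq]
      convert this using 1 <;> push_cast <;> ring
    · intro hd
      simpa using Dglue _ _ (Dglue _ _ hd)
  have Pper : ∀ s, P (s + 2 * lam + 2 * lam) = P s := fun s => by simp only [hP, Dper]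
  have Plip : ∀ s s', s ≤ s' → |P s - P s'| ≤ s' - s := by
    intro s s' hss
    have h1 := Pmem s
    have h2 := Pmem s'
    simp only [hD, mem_ofPred_eq] at h1 h2
    rw [abs_le]
    constructor
    · by_contra! hlt
      have := h.isBend_of_crossing (c := (s' - P s') / 2) (d := s - (s' - P s') / 2) h2 h1
        ⟨by linarith, by linarith⟩ ⟨by linarith, by linarith⟩
      have := Pge _ _ this
      rw [add_sub_cancel] at this
      linarith
    · by_contra! hlt
      have := h.isBend_of_crossing (c := s' - (s + P s) / 2) (d := (s + P s) / 2) h1 h2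
        ⟨by linarith, by linarith⟩ ⟨by linarith, by linarith⟩
      have := Pge _ _ this
      rw [sub_add_cancel] at this
      linarith
  have Plip' : ∀ s s', |P s - P s'| ≤ |s - s'| := by
    intro s s'
    rcases le_total s s' with hs | hs
    · rw [abs_sub_comm s s']
      exact (Plip s s' hs).trans (le_abs_self _)
    · rw [abs_sub_comm (P s) (P s')]
      exact (Plip s' s hs).trans (le_abs_self _)
  refine ⟨fun s => (P s - P (s + 2 * lam)) / 2, fun s => ?_, fun s => ?_, fun s s' => ?_⟩
  · have h1 := Pmem s
    have h2 := Dglue _ _ (Pmem (s + 2 * lam))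
    rw [Dper] at h2
    have hle : - P (s + 2 * lam) ≤ P s := le_csSup (Dbd s) h2
    simp only [hD, mem_ofPred_eq] at h1 h2
    exact h.isBend_of_crossing h1 h2 ⟨by linarith, by linarith⟩ ⟨by linarith, by linarith⟩
  · simp only [Pper]
    ring
  · have h1 := abs_le.1 (Plip' s s')
    have h2 := Plip' (s + 2 * lam) (s' + 2 * lam)
    rw [add_sub_add_right_eq_sub] at h2
    have h2 := abs_le.1 h2
    rw [abs_le]
    constructor <;> linarith [h1.1, h1.2, h2.1, h2.2]

end IsMoebius

/-! ### A winding argument -/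

theorem eq_of_continuousOn_of_int_valued {f : ℝ → ℝ} {c : ℝ} (hc : 0 ≤ c)
    (hf : ContinuousOn f (Icc 0 c)) (hint : ∀ t ∈ Icc 0 c, ∃ n : ℤ, f t = n) : f 0 = f c := by
  have hd : IsDiscrete (range ((↑) : ℤ → ℝ)) :=
    Int.isClosedEmbedding_coe_real.isEmbedding.isDiscrete_range
  obtain ⟨y, -, hy⟩ := isPreconnected_Icc.eqOn_const_of_mapsTo hd hf
    (fun t ht => by obtain ⟨n, hn⟩ := hint t ht; exact ⟨n, hn.symm⟩) (range_nonempty _)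
  rw [hy ⟨le_rfl, hc⟩, hy ⟨hc, le_rfl⟩]
  rfl

/-- A continuous planar function on a strip which is nonnegative on the lower edge and odd
under `(x, t) ↦ (x + t, c - t)` has a zero. -/
theorem exists_zero_of_odd {Z : ℝ × ℝ → ℂ} (hZ : Continuous Z) {c : ℝ} (hc : 0 < c)
    (hodd : ∀ x t, Z (x + t, c - t) = - Z (x, t))
    (hpos : ∀ x, ∃ r : ℝ, 0 ≤ r ∧ Z (x, 0) = r) :
    ∃ x, ∃ t ∈ Icc 0 c, Z (x, t) = 0 := by
  by_contra! hne
  have simplyConnected_univ : IsSimplyConnected (univ : Set (ℝ × ℝ)) := by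
    have := (convex_univ (𝕜 := ℝ) (E := ℝ × ℝ)).contractibleSpace univ_nonempty
    exact SimplyConnectedSpace.ofContractible _
  obtain ⟨θ, hθ, hexp⟩ := Complex.exists_continuousOn_eqOn_exp_comp
    (U := (univ : Set (ℝ × ℝ))) (g := fun p => Z (p.1, projIcc 0 c hc.le p.2))
    simplyConnected_univ isOpen_univ
    (by fun_prop)
    (by
      rintro ⟨p, -, hp⟩
      exact hne _ _ (projIcc 0 c hc.le p.2).2 hp)
  rw [continuousOn_univ] at hθ
  have hexp' : ∀ x, ∀ t ∈ Icc 0 c, Complex.exp (θ (x, t)) = Z (x, t) := by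
    intro x t ht
    have := hexp (mem_univ (x, t))
    simpa [projIcc_of_mem hc.le ht] using this
  have twopi : (2 * Real.pi) ≠ 0 := by positivity
  have h1 : ∀ t ∈ Icc 0 c, ∃ n : ℤ,
      ((θ (t, c - t) - θ (0, t)).im - Real.pi) / (2 * Real.pi) = n := by
    intro t ht
    have e : Complex.exp (θ (t, c - t) - θ (0, t)) = Complex.exp (Real.pi * Complex.I) := by
      have := hodd 0 t
      rw [zero_add] at this
      rw [Complex.exp_sub, hexp' _ _ ⟨by linarith [ht.2], by linarith [ht.1]⟩, hexp' _ _ ht,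
        this, neg_div, div_self (hne _ _ ht), Complex.exp_pi_mul_I]
    obtain ⟨n, hn⟩ := Complex.exp_eq_exp_iff_exists_int.1 e
    refine ⟨n, ?_⟩
    rw [hn, div_eq_iff twopi]
    simp
  have h2 : ∀ t ∈ Icc 0 c, ∃ n : ℤ, (θ (t, 0)).im / (2 * Real.pi) = n := by
    intro t _
    obtain ⟨r, hr0, hr⟩ := hpos t
    have hr' := hexp' t 0 ⟨le_rfl, hc.le⟩
    have hne' := hne t 0 ⟨le_rfl, hc.le⟩
    rw [hr] at hne' hr'
    have hrp : 0 < r := lt_of_le_of_ne hr0 (by rintro rfl; simp at hne')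
    rw [← Complex.exp_log hne'] at hr'
    obtain ⟨n, hn⟩ := Complex.exp_eq_exp_iff_exists_int.1 hr'
    refine ⟨n, ?_⟩
    rw [hn, div_eq_iff twopi, ← Complex.ofReal_log hr0]
    simp
  have k1 := eq_of_continuousOn_of_int_valued hc.le
    (Continuous.continuousOn (by fun_prop)) h1
  have k2 := eq_of_continuousOn_of_int_valued hc.le
    (Continuous.continuousOn (by fun_prop)) h2
  obtain ⟨n, hn⟩ := h1 0 ⟨le_rfl, hc.le⟩
  rw [div_left_inj' twopi] at k1 k2
  rw [div_eq_iff twopi] at hn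
  simp only [sub_zero, sub_self, Complex.sub_im] at k1 hn
  have : ((2 * n + 1 : ℤ) : ℝ) * Real.pi = (0 : ℤ) * Real.pi := by
    push_cast
    linarith
  have := mul_right_cancel₀ Real.pi_ne_zero this
  norm_cast at this
  omega

/-! ### Perpendicular coplanar bends -/

/-- The triple product in three-space. -/
def tripleProduct (u v w : Space) : ℝ :=
  u 0 * (v 1 * w 2 - v 2 * w 1) - u 1 * (v 0 * w 2 - v 2 * w 0) + u 2 * (v 0 * w 1 - v 1 * w 0)

theorem tripleProduct_sq (u v w : Space) : tripleProduct u v w ^ 2 =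
    ⟪u, u⟫ * ⟪v, v⟫ * ⟪w, w⟫ + 2 * ⟪u, v⟫ * ⟪u, w⟫ * ⟪v, w⟫ - ⟪u, u⟫ * ⟪v, w⟫ ^ 2
      - ⟪v, v⟫ * ⟪u, w⟫ ^ 2 - ⟪w, w⟫ * ⟪u, v⟫ ^ 2 := by
  simp only [tripleProduct, PiLp.inner_apply, Fin.sum_univ_three, RCLike.inner_apply, conj_trivial]
  ring

theorem tripleProduct_sub_smul (u v w : Space) (r s : ℝ) :
    tripleProduct (u - r • v - s • w) v w = tripleProduct u v w := by
  simp only [tripleProduct, PiLp.sub_apply, PiLp.smul_apply, smul_eq_mul]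
  ring

theorem exists_eq_add_of_tripleProduct_eq_zero {u v w : Space} (hv : v ≠ 0) (hw : w ≠ 0)
    (hvw : ⟪v, w⟫ = 0) (hdet : tripleProduct u v w = 0) : ∃ α γ : ℝ, u = α • v + γ • w := by
  have hv' : ⟪v, v⟫ ≠ 0 := inner_self_ne_zero.2 hv
  have hw' : ⟪w, w⟫ ≠ 0 := inner_self_ne_zero.2 hw
  refine ⟨⟪u, v⟫ / ⟪v, v⟫, ⟪u, w⟫ / ⟪w, w⟫, ?_⟩
  set z := u - (⟪u, v⟫ / ⟪v, v⟫) • v - (⟪u, w⟫ / ⟪w, w⟫) • w with hz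
  have hzv : ⟪z, v⟫ = 0 := by
    rw [hz, inner_sub_left, inner_sub_left, inner_smul_left, inner_smul_left,
      real_inner_comm v w, hvw, conj_trivial, div_mul_cancel₀ _ hv']
    simp
  have hzw : ⟪z, w⟫ = 0 := by
    rw [hz, inner_sub_left, inner_sub_left, inner_smul_left, inner_smul_left, hvw,
      conj_trivial, conj_trivial, div_mul_cancel₀ _ hw']
    simp
  have h1 := tripleProduct_sq z v w
  rw [hz, tripleProduct_sub_smul, hdet, ← hz, hzv, hzw, hvw] at h1
  have h2 : ⟪z, z⟫ * (⟪v, v⟫ * ⟪w, w⟫) = 0 := by linarith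
  have h3 := inner_self_eq_zero.1 ((mul_eq_zero.1 h2).resolve_right (mul_ne_zero hv' hw'))
  rw [hz, sub_sub, sub_eq_zero] at h3
  exact h3

namespace IsMoebius

variable {lam : ℝ} {F : ℝ × ℝ → Space}

theorem exists_perpendicular_coplanar (h : IsMoebius lam F) {a b : ℝ → ℝ} (ha : Continuous a)
    (hb : Continuous b) (hab : ∀ s, IsBend F (a s) (b s))
    (ha' : ∀ s, a (s + 2 * lam) = b s + lam) (hb' : ∀ s, b (s + 2 * lam) = a s + lam) :
    ∃ s s' : ℝ, s < s' ∧ s' < s + 2 * lam ∧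
      ⟪F (b s, 1) - F (a s, 0), F (b s', 1) - F (a s', 0)⟫ = 0 ∧
      ∃ α γ : ℝ, F (a s', 0) = F (a s, 0) + α • (F (b s, 1) - F (a s, 0))
        + γ • (F (b s', 1) - F (a s', 0)) := by
  have hF := h.smooth.continuous
  set P : ℝ → Space := fun s => F (a s, 0) with hP
  set u : ℝ → Space := fun s => F (b s, 1) - F (a s, 0) with hu
  have hPc : Continuous P := by fun_prop
  have huc : Continuous u := by fun_prop
  have hPper : ∀ s, P (s + 2 * lam) = F (b s, 1) := by
    intro s
    simp only [hP, ha']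
    have := h.glue (b s) 1 (by simp)
    rwa [sub_self] at this
  have huper : ∀ s, u (s + 2 * lam) = - u s := by
    intro s
    have h1 := hPper s
    have h2 := h.glue (a s) 0 (by simp)
    simp only [hP] at h1
    rw [sub_zero] at h2
    simp only [hu, h1, hb', h2]
    abel
  have hPu : ∀ s, P (s + 2 * lam) = P s + u s := by
    intro s
    rw [hPper]
    simp only [hP, hu]
    abel
  have hune : ∀ s, u s ≠ 0 := by
    intro s h0
    have := hab s
    unfold IsBend at this
    simp only [hu] at h0
    rw [h0] at this
    simp only [norm_zero] at this
    nlinarith [sq_nonneg (b s - a s)]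
  set Z : ℝ × ℝ → ℂ := fun p => ⟨⟪u p.1, u (p.1 + p.2)⟫,
    tripleProduct (P p.1 - P (p.1 + p.2)) (u p.1) (u (p.1 + p.2))⟩ with hZ
  have hZc : Continuous Z := by
    have e : Z = fun p => Complex.equivRealProdCLM.symm (⟪u p.1, u (p.1 + p.2)⟫,
        tripleProduct (P p.1 - P (p.1 + p.2)) (u p.1) (u (p.1 + p.2))) := by
      funext p
      rfl
    rw [e]
    refine Complex.equivRealProdCLM.symm.continuous.comp (Continuous.prodMk (by fun_prop) ?_)
    unfold tripleProduct
    fun_prop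
  obtain ⟨x, t, ht, hzero⟩ := exists_zero_of_odd hZc (c := 2 * lam) (by linarith [h.pos])
    (fun x t => by
      simp only [hZ]
      rw [show x + t + (2 * lam - t) = x + 2 * lam by ring, huper, hPu]
      apply Complex.ext
      · simp only [Complex.neg_re]
        rw [inner_neg_right, real_inner_comm]
      · simp only [Complex.neg_im, tripleProduct, PiLp.sub_apply, PiLp.add_apply, PiLp.neg_apply]
        ring)
    (fun x => by
      refine ⟨⟪u x, u x⟫, real_inner_self_nonneg, ?_⟩
      simp only [hZ, add_zero, sub_self]
      apply Complex.ext
      · rw [Complex.ofReal_re]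
      · simp only [Complex.ofReal_im, tripleProduct, PiLp.zero_apply]
        ring)
  have hre : ⟪u x, u (x + t)⟫ = 0 := congrArg Complex.re hzero
  have him : tripleProduct (P x - P (x + t)) (u x) (u (x + t)) = 0 := congrArg Complex.im hzero
  refine ⟨x, x + t, ?_, ?_, hre, ?_⟩
  · refine lt_of_le_of_ne (by linarith [ht.1]) fun h0 => ?_
    rw [← h0, inner_self_eq_zero] at hre
    exact hune x hre
  · refine lt_of_le_of_ne (by linarith [ht.2]) fun h0 => ?_
    rw [h0, huper, inner_neg_right, neg_eq_zero, inner_self_eq_zero] at hre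
    exact hune x hre
  · obtain ⟨α, γ, hαγ⟩ := exists_eq_add_of_tripleProduct_eq_zero (hune _) (hune _) hre him
    refine ⟨-α, -γ, ?_⟩
    have : P (x + t) = P x - (α • u x + γ • u (x + t)) := by rw [← hαγ]; abel
    change P (x + t) = P x + -α • u x + -γ • u (x + t)
    rw [this]
    module

theorem exists_monotone_bends (h : IsMoebius lam F) : ∃ a b : ℝ → ℝ,
    Continuous a ∧ Continuous b ∧ Monotone a ∧ Monotone b ∧ (∀ s, a s + b s = s) ∧
    (∀ s, IsBend F (a s) (b s)) ∧
    (∀ s, a (s + 2 * lam) = b s + lam) ∧ ∀ s, b (s + 2 * lam) = a s + lam := by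
  obtain ⟨m, hbend, hper, hlip⟩ := h.exists_bend_family
  have hm : Continuous m := (LipschitzWith.of_dist_le_mul (K := 1) fun s s' => by
    simpa [Real.dist_eq] using hlip s s').continuous
  refine ⟨fun s => (s - m s) / 2, fun s => (s + m s) / 2, by fun_prop, by fun_prop, ?_, ?_,
    fun s => by ring, hbend, fun s => by simp only [hper]; ring, fun s => by simp only [hper]; ring⟩
  all_goals
    intro s s' hs
    have := hlip s s'
    rw [abs_sub_comm s s', abs_of_nonneg (sub_nonneg.2 hs), abs_le] at this
    simp only
    linarith [this.1, this.2]

end IsMoebius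

/-! ### Embedded bands -/

/-- Injectivity of a band modulo the Moebius identification. -/
def IsEmbedded (lam : ℝ) (F : ℝ × ℝ → Space) : Prop :=
  ∀ x x' y y' : ℝ, x ∈ Ico (0 : ℝ) lam → x' ∈ Ico (0 : ℝ) lam →
    y ∈ Icc (0 : ℝ) 1 → y' ∈ Icc (0 : ℝ) 1 → F (x, y) = F (x', y') → x = x' ∧ y = y'

namespace IsMoebius

variable {lam : ℝ} {F : ℝ × ℝ → Space}

/-- Reduction of a point of the strip to the fundamental domain. -/
theorem exists_reduction (h : IsMoebius lam F) (x : ℝ) {y : ℝ} (hy : y ∈ Icc (0 : ℝ) 1) :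
    ∃ (x₀ y₀ : ℝ) (n : ℤ), x₀ ∈ Ico (0 : ℝ) lam ∧ y₀ ∈ Icc (0 : ℝ) 1 ∧ F (x, y) = F (x₀, y₀) ∧
      (x = x₀ + n * (2 * lam) ∧ y = y₀ ∨ x = x₀ + lam + n * (2 * lam) ∧ y = 1 - y₀) := by
  have hpos := h.pos
  set n : ℤ := ⌊x / (2 * lam)⌋
  set r : ℝ := x - n * (2 * lam)
  have hr0 : 0 ≤ r := by
    have := Int.floor_le (x / (2 * lam))
    rw [le_div_iff₀ (by linarith)] at this
    simp only [r, n]; linarith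
  have hr1 : r < 2 * lam := by
    have := Int.lt_floor_add_one (x / (2 * lam))
    rw [div_lt_iff₀ (by linarith)] at this
    simp only [r, n]; linarith
  have hF : F (x, y) = F (r, y) := by
    rw [← h.add_int_mul n r hy]
    simp [r]
  rcases lt_or_ge r lam with hl | hl
  · exact ⟨r, y, n, ⟨hr0, hl⟩, hy, hF, Or.inl ⟨by simp [r], rfl⟩⟩
  · have hy' : 1 - y ∈ Icc (0 : ℝ) 1 := ⟨by linarith [hy.2], by linarith [hy.1]⟩
    refine ⟨r - lam, 1 - y, n, ⟨by linarith, by linarith⟩, hy', ?_,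
      Or.inr ⟨by simp [r], by ring⟩⟩
    rw [hF, ← h.glue (r - lam) (1 - y) hy']
    simp

theorem eq_or_eq_of_apply_eq (h : IsMoebius lam F) (hF : IsEmbedded lam F) {x x' y y' : ℝ}
    (hy : y ∈ Icc (0 : ℝ) 1) (hy' : y' ∈ Icc (0 : ℝ) 1) (heq : F (x, y) = F (x', y')) :
    ∃ n : ℤ, x' = x + n * (2 * lam) ∧ y' = y ∨ x' = x + lam + n * (2 * lam) ∧ y' = 1 - y := by
  obtain ⟨x₀, y₀, n, hx₀, hy₀, h0, hn⟩ := h.exists_reduction x hy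
  obtain ⟨x₁, y₁, m, hx₁, hy₁, h1, hm⟩ := h.exists_reduction x' hy'
  obtain ⟨rfl, rfl⟩ := hF _ _ _ _ hx₀ hx₁ hy₀ hy₁ (by rw [← h0, heq, h1])
  rcases hn with ⟨hn, hn'⟩ | ⟨hn, hn'⟩ <;> rcases hm with ⟨hm, hm'⟩ | ⟨hm, hm'⟩
  · exact ⟨m - n, Or.inl ⟨by push_cast; linarith, by linarith⟩⟩
  · exact ⟨m - n, Or.inr ⟨by push_cast; linarith, by linarith⟩⟩
  · exact ⟨m - n - 1, Or.inr ⟨by push_cast; linarith, by linarith⟩⟩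
  · exact ⟨m - n, Or.inl ⟨by push_cast; linarith, by linarith⟩⟩

theorem one_le_norm_of_isBend {a b : ℝ} (hab : IsBend F a b) : 1 ≤ ‖F (b, 1) - F (a, 0)‖ := by
  unfold IsBend at hab
  nlinarith [norm_nonneg (F (b, 1) - F (a, 0)), sq_nonneg (b - a)]

/-- The triangle of bends that produces the sharp lower bound on the aspect ratio. -/
structure IsTriangle (lam : ℝ) (F : ℝ × ℝ → Space) (a b c α : ℝ) (w : Space) : Prop where
  bend : IsBend F a b
  le_add : b ≤ a + lam
  left_le : a ≤ c
  le_right : c ≤ b + lam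
  inner_eq : ⟪w, F (b, 1) - F (a, 0)⟫ = 0
  one_le : 1 ≤ ‖w‖
  eq : F (c, 0) = F (a, 0) + α • (F (b, 1) - F (a, 0)) + w

theorem exists_isTriangle (h : IsMoebius lam F) (hF : IsEmbedded lam F) :
    ∃ (a b c α : ℝ) (w : Space), IsTriangle lam F a b c α w := by
  obtain ⟨a, b, ha, hb, hma, hmb, hsum, hab, ha', hb'⟩ := h.exists_monotone_bends
  obtain ⟨s, s', hs, hs', hperp, α, γ, hcop⟩ := h.exists_perpendicular_coplanar ha hb hab ha' hb'
  have hpos := h.pos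
  set P : ℝ → Space := fun s => F (a s, 0) with hP
  set u : ℝ → Space := fun s => F (b s, 1) - F (a s, 0) with hu
  have g0 : ∀ x, F (x + lam, 1) = F (x, 0) := fun x => by
    simpa using h.glue x 0 (by simp)
  have g1 : ∀ x, F (x + lam, 0) = F (x, 1) := fun x => by
    simpa using h.glue x 1 (by simp)
  have hPu : ∀ s, P (s + 2 * lam) = P s + u s := fun s => by
    simp only [hP, hu, ha', g1]; abel
  have huu : ∀ s, u (s + 2 * lam) = -u s := fun s => by
    simp only [hu, ha', hb', g0, g1]; abel
  have hnorm : ∀ s, 1 ≤ ‖u s‖ := fun s => one_le_norm_of_isBend (hab s)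
  have main : ∀ {σ σ' β : ℝ} {w : Space}, σ ≤ σ' → σ' ≤ σ + 2 * lam → ⟪w, u σ⟫ = 0 → 1 ≤ ‖w‖ →
      P σ' = P σ + β • u σ + w → ∃ (a b c α : ℝ) (w : Space), IsTriangle lam F a b c α w := by
    intro σ σ' β w h1 h2 h3 h4 h5
    exact ⟨a σ, b σ, a σ', β, w, hab σ, by rw [← hb']; exact hmb (by linarith), hma h1,
      by rw [← ha']; exact hma h2, h3, h4, h5⟩
  have hn : ∀ (r s : ℝ), 1 ≤ |r| → 1 ≤ ‖r • u s‖ := fun r s hr => by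
    rw [norm_smul, Real.norm_eq_abs]
    nlinarith [hnorm s]
  change ⟪u s, u s'⟫ = 0 at hperp
  change P s' = P s + α • u s + γ • u s' at hcop
  have hperp' : ⟪u s', u s⟫ = 0 := by rw [real_inner_comm, hperp]
  rcases le_or_gt γ (-1) with hγ | hγ
  · exact main (w := γ • u s') hs.le hs'.le (by rw [inner_smul_left, hperp', mul_zero])
      (hn _ _ (by rw [abs_of_neg (by linarith)]; linarith)) hcop
  rcases le_or_gt 0 γ with hγ0 | hγ0
  · refine main (σ := s + 2 * lam) (σ' := s' + 2 * lam) (β := 1 - α) (w := (γ + 1) • u s')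
      (by linarith) (by linarith) (by rw [huu, inner_neg_right, inner_smul_left, hperp']; simp)
      (hn _ _ (by rw [abs_of_pos (by linarith)]; linarith)) ?_
    rw [hPu, hPu, huu, hcop]
    module
  rcases le_or_gt α 0 with hα | hα
  · refine main (σ := s') (σ' := s + 2 * lam) (β := -γ) (w := (1 - α) • u s)
      hs'.le (by linarith) (by rw [inner_smul_left, hperp, mul_zero])
      (hn _ _ (by rw [abs_of_pos (by linarith)]; linarith)) ?_
    rw [hPu, hcop]
    module
  rcases le_or_gt 1 α with hα1 | hα1
  · refine main (σ := s' + 2 * lam) (σ' := s + 2 * lam + 2 * lam) (β := γ + 1) (w := (-α) • u s)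
      (by linarith) (by linarith) (by rw [huu, inner_neg_right, inner_smul_left, hperp]; simp)
      (hn _ _ (by rw [abs_of_neg (by linarith)]; linarith)) ?_
    rw [hPu, hPu, hPu, huu, huu, hcop]
    module
  · exfalso
    have hαI : α ∈ Icc (0 : ℝ) 1 := ⟨hα.le, hα1.le⟩
    have hγI : -γ ∈ Icc (0 : ℝ) 1 := ⟨by linarith, by linarith⟩
    have e1 := h.apply_bend (hab s) hαI
    have e2 := h.apply_bend (hab s') hγI
    have e : F ((1 - α) * a s + α * b s, α) = F ((1 - -γ) * a s' + -γ * b s', -γ) := by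
      rw [e1, e2]
      change P s + α • u s = P s' + -γ • u s'
      rw [hcop]
      module
    have hstrict : ∀ {y : ℝ}, 0 < y → y < 1 → ∀ {σ σ' : ℝ}, σ < σ' →
        (1 - y) * a σ + y * b σ < (1 - y) * a σ' + y * b σ' := by
      intro y hy0 hy1 σ σ' hσ
      have h1 := hma hσ.le
      have h2 := hmb hσ.le
      have h3 := hsum σ
      have h4 := hsum σ'
      rcases h1.lt_or_eq with h5 | h5
      · nlinarith [mul_lt_mul_of_pos_left h5 (sub_pos.2 hy1), mul_le_mul_of_nonneg_left h2 hy0.le]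
      · nlinarith [mul_lt_mul_of_pos_left (show b σ < b σ' by linarith) hy0]
    obtain ⟨n, ⟨hn1, hn2⟩ | ⟨hn1, hn2⟩⟩ := h.eq_or_eq_of_apply_eq hF hαI hγI e
    · rw [hn2] at hn1
      have k1 := hstrict hα hα1 hs
      have k2 := hstrict hα hα1 (show s' < s + 2 * lam + 2 * lam by linarith)
      rw [ha', hb', hb', ha'] at k2
      have k3 : (0 : ℝ) < n := by
        by_contra! hc
        nlinarith
      have k4 : (n : ℝ) < 1 := by
        by_contra! hc
        nlinarith
      have k5 : 0 < n := by exact_mod_cast k3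
      have k6 : n < 1 := by exact_mod_cast k4
      omega
    · rw [hn2] at hn1
      have k1 := hstrict (y := 1 - α) (by linarith) (by linarith) hs'
      have k2 := hstrict (y := 1 - α) (by linarith) (by linarith)
        (show s - 2 * lam < s' by linarith)
      rw [ha', hb'] at k1
      have ha2 := ha' (s - 2 * lam)
      have hb2 := hb' (s - 2 * lam)
      rw [sub_add_cancel] at ha2 hb2
      have k3 : (-1 : ℝ) < n := by
        by_contra! hc
        nlinarith
      have k4 : (n : ℝ) < 0 := by
        by_contra! hc
        nlinarith
      have k5 : -1 < n := by exact_mod_cast k3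
      have k6 : n < 0 := by exact_mod_cast k4
      omega

end IsMoebius

/-! ### Quantitative estimates for the extremal triangle -/

/-- The metric data of a triangle inscribed in a band of aspect ratio `lam`: the base has length
`t` and slope `τ`, the apex is at height `D` and offset `x` from the midpoint of the base, and
`p`, `q` bound the lengths `L₁`, `L₂` of the other two sides. -/
structure TriangleData (ε lam τ p q t D x L₁ L₂ : ℝ) : Prop where
  eps_pos : 0 < ε
  eps_lt : ε < 1 / 384
  lam_lt : lam < Real.sqrt 3 + ε
  lam_pos : 0 < lam
  perimeter : p + q = lam + τ
  t_pos : 0 < t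
  t_sq : t ^ 2 = 1 + τ ^ 2
  t_le : t ≤ lam - τ
  one_le : 1 ≤ D
  L₁_nonneg : 0 ≤ L₁
  L₂_nonneg : 0 ≤ L₂
  L₁_sq : L₁ ^ 2 = (t / 2 + x) ^ 2 + D ^ 2
  L₂_sq : L₂ ^ 2 = (t / 2 - x) ^ 2 + D ^ 2
  L₁_le : L₁ ≤ p
  L₂_le : L₂ ≤ q
  L₁_sq_le : L₁ ^ 2 ≤ 1 + (q - τ) ^ 2
  L₂_sq_le : L₂ ^ 2 ≤ 1 + (p - τ) ^ 2

namespace TriangleData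

variable {ε lam τ p q t D x L₁ L₂ : ℝ}

theorem lam_sq_le (T : TriangleData ε lam τ p q t D x L₁ L₂) : lam ^ 2 ≤ 3 + 3.5 * ε := by
  have h3 : Real.sqrt 3 ^ 2 = 3 := Real.sq_sqrt (by norm_num)
  have h4 : Real.sqrt 3 < 1.7321 := by
    rw [Real.sqrt_lt' (by norm_num)]; norm_num
  have := T.lam_lt
  have := T.lam_pos
  have := T.eps_pos
  have := T.eps_lt
  have : lam ^ 2 ≤ (Real.sqrt 3 + ε) ^ 2 := by gcongr
  nlinarith

theorem side_mul (T : TriangleData ε lam τ p q t D x L₁ L₂) :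
    (L₁ * L₂) ^ 2 = (t ^ 2 / 4 - x ^ 2 + D ^ 2) ^ 2 + 4 * D ^ 2 * x ^ 2 := by
  rw [mul_pow, T.L₁_sq, T.L₂_sq]
  ring

theorem le_side_mul (T : TriangleData ε lam τ p q t D x L₁ L₂) :
    t ^ 2 / 4 - x ^ 2 + D ^ 2 ≤ L₁ * L₂ := by
  apply le_of_sq_le_sq _ (mul_nonneg T.L₁_nonneg T.L₂_nonneg)
  rw [T.side_mul]
  nlinarith [sq_nonneg (D * x)]

theorem le_sum_sq (T : TriangleData ε lam τ p q t D x L₁ L₂) :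
    t ^ 2 + 4 * D ^ 2 ≤ (L₁ + L₂) ^ 2 := by
  nlinarith [T.le_side_mul, T.L₁_sq, T.L₂_sq]

theorem sum_le (T : TriangleData ε lam τ p q t D x L₁ L₂) : L₁ + L₂ ≤ lam + τ := by
  linarith [T.L₁_le, T.L₂_le, T.perimeter]

theorem lam_tau_lower (T : TriangleData ε lam τ p q t D x L₁ L₂) :
    1 + 4 * D ^ 2 ≤ lam ^ 2 + 2 * (lam * τ) := by
  have h1 : (L₁ + L₂) ^ 2 ≤ (lam + τ) ^ 2 := by
    have := T.sum_le
    have := T.L₁_nonneg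
    have := T.L₂_nonneg
    gcongr
  nlinarith [T.le_sum_sq, T.t_sq]

theorem lam_tau_upper (T : TriangleData ε lam τ p q t D x L₁ L₂) :
    2 * (lam * τ) ≤ lam ^ 2 - 1 := by
  have h1 : t ^ 2 ≤ (lam - τ) ^ 2 := by
    have := T.t_le
    have := T.t_pos
    gcongr
  nlinarith [T.t_sq]

theorem one_le_D_sq (T : TriangleData ε lam τ p q t D x L₁ L₂) : 1 ≤ D ^ 2 := by
  nlinarith [T.one_le]

theorem three_le (T : TriangleData ε lam τ p q t D x L₁ L₂) : 3 ≤ lam ^ 2 := by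
  linarith [T.lam_tau_lower, T.lam_tau_upper, T.one_le_D_sq]

theorem lam_ge (T : TriangleData ε lam τ p q t D x L₁ L₂) : 1.732 ≤ lam := by
  nlinarith [T.three_le, T.lam_pos]

theorem lam_le (T : TriangleData ε lam τ p q t D x L₁ L₂) : lam ≤ 1.74 := by
  nlinarith [T.lam_sq_le, T.lam_pos, T.eps_lt]

theorem tau_pos (T : TriangleData ε lam τ p q t D x L₁ L₂) : 0 < τ := by
  have := T.lam_tau_lower
  have := T.lam_sq_le
  have := T.eps_lt
  have := T.one_le_D_sq
  have : 0 < lam * τ := by linarith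
  exact pos_of_mul_pos_right this T.lam_pos.le

theorem tau_le (T : TriangleData ε lam τ p q t D x L₁ L₂) : τ ≤ 0.59 := by
  nlinarith [T.lam_ge, T.lam_tau_upper, T.lam_sq_le, T.eps_lt]

theorem D_le (T : TriangleData ε lam τ p q t D x L₁ L₂) : D ≤ 1 + ε := by
  nlinarith [T.lam_tau_lower, T.lam_tau_upper, T.lam_sq_le, T.one_le, T.eps_pos]

theorem one_le_t (T : TriangleData ε lam τ p q t D x L₁ L₂) : 1 ≤ t := by
  nlinarith [T.t_sq, T.t_pos, sq_nonneg τ]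

theorem top_defect (T : TriangleData ε lam τ p q t D x L₁ L₂) : (lam - τ) ^ 2 - t ^ 2 ≤ 7 * ε := by
  nlinarith [T.t_sq, T.lam_tau_lower, T.one_le_D_sq, T.lam_sq_le]

theorem top_gap (T : TriangleData ε lam τ p q t D x L₁ L₂) : lam - τ - t ≤ 3.5 * ε := by
  nlinarith [T.top_defect, T.one_le_t, T.t_le]

theorem perimeter_defect (T : TriangleData ε lam τ p q t D x L₁ L₂) :
    (lam + τ) ^ 2 - (t ^ 2 + 4 * D ^ 2) ≤ 7 * ε := by
  nlinarith [T.t_sq, T.lam_tau_upper, T.one_le_D_sq, T.lam_sq_le]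

theorem perimeter_gap (T : TriangleData ε lam τ p q t D x L₁ L₂) :
    lam + τ - (L₁ + L₂) ≤ 1.75 * ε := by
  have h1 : 2 ≤ L₁ + L₂ := by
    nlinarith [T.le_sum_sq, T.one_le_D_sq, T.L₁_nonneg, T.L₂_nonneg, sq_nonneg t]
  nlinarith [T.perimeter_defect, T.le_sum_sq, T.sum_le]

theorem left_defect (T : TriangleData ε lam τ p q t D x L₁ L₂) : p ^ 2 - L₁ ^ 2 ≤ 12 * ε := by
  have h1 : p - L₁ ≤ 1.75 * ε := by linarith [T.perimeter_gap, T.L₂_le, T.perimeter]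
  have h2 : p + L₁ ≤ 4.7 := by
    linarith [T.L₁_le, T.L₂_le, T.perimeter, T.L₂_nonneg, T.lam_le, T.tau_le]
  nlinarith [T.L₁_le, T.L₁_nonneg, T.eps_pos]

theorem right_defect (T : TriangleData ε lam τ p q t D x L₁ L₂) : q ^ 2 - L₂ ^ 2 ≤ 12 * ε := by
  have h1 : q - L₂ ≤ 1.75 * ε := by linarith [T.perimeter_gap, T.L₁_le, T.perimeter]
  have h2 : q + L₂ ≤ 4.7 := by
    linarith [T.L₁_le, T.L₂_le, T.perimeter, T.L₁_nonneg, T.lam_le, T.tau_le]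
  nlinarith [T.L₂_le, T.L₂_nonneg, T.eps_pos]

theorem offset_sq_le (T : TriangleData ε lam τ p q t D x L₁ L₂) : x ^ 2 ≤ 4 * ε := by
  set M := t ^ 2 / 4 - x ^ 2 + D ^ 2 with hM
  have h1 : L₁ * L₂ - M ≤ 3.5 * ε := by
    have : (L₁ + L₂) ^ 2 ≤ (lam + τ) ^ 2 := by
      have := T.sum_le
      have := T.L₁_nonneg
      have := T.L₂_nonneg
      gcongr
    linarith [T.perimeter_defect, T.L₁_sq, T.L₂_sq, add_sq L₁ L₂, add_sq (t / 2) x, sub_sq (t / 2) x,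
      div_pow t 2 2]
  have h2 : L₁ * L₂ ≤ 1.5 := by
    have h3 : L₁ + L₂ ≤ 2.33 := by linarith [T.sum_le, T.lam_le, T.tau_le]
    nlinarith [sq_nonneg (L₁ - L₂), T.L₁_nonneg, T.L₂_nonneg]
  have h3 : (L₁ * L₂ - M) * (L₁ * L₂ + M) = 4 * D ^ 2 * x ^ 2 := by
    have := T.side_mul
    simp only [M]
    linarith
  have h4 : 0 ≤ L₁ * L₂ - M := sub_nonneg.2 T.le_side_mul
  have h5 : (L₁ * L₂ - M) * (L₁ * L₂ + M) ≤ 3.5 * ε * 3 := by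
    have : L₁ * L₂ + M ≤ 3 := by linarith
    calc _ ≤ (L₁ * L₂ - M) * 3 := by gcongr
      _ ≤ _ := by gcongr
  nlinarith [T.one_le_D_sq, sq_nonneg x, T.eps_pos]

theorem left_le (T : TriangleData ε lam τ p q t D x L₁ L₂) : t / 2 + x ≤ q - τ := by
  have h1 : 1 ≤ L₂ := by nlinarith [T.L₂_sq, T.one_le_D_sq, sq_nonneg (t / 2 - x), T.L₂_nonneg]
  apply le_of_sq_le_sq _ (by linarith [T.L₂_le, T.tau_le])
  nlinarith [T.L₁_sq, T.L₁_sq_le, T.one_le_D_sq]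

theorem right_le (T : TriangleData ε lam τ p q t D x L₁ L₂) : t / 2 - x ≤ p - τ := by
  have h1 : 1 ≤ L₁ := by nlinarith [T.L₁_sq, T.one_le_D_sq, sq_nonneg (t / 2 + x), T.L₁_nonneg]
  apply le_of_sq_le_sq _ (by linarith [T.L₁_le, T.tau_le])
  nlinarith [T.L₂_sq, T.L₂_sq_le, T.one_le_D_sq]

theorem offset_abs_le (T : TriangleData ε lam τ p q t D x L₁ L₂) : |x| ≤ 1 / 4 := by
  rw [← Real.sqrt_sq_eq_abs, Real.sqrt_le_left (by norm_num)]
  nlinarith [T.offset_sq_le, T.eps_lt]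

theorem right_diag_defect (T : TriangleData ε lam τ p q t D x L₁ L₂) :
    1 + (p - τ) ^ 2 - L₂ ^ 2 ≤ 12 * ε := by
  have h1 : p - τ - (t / 2 - x) ≤ 3.5 * ε := by
    linarith [T.left_le, T.top_gap, T.perimeter]
  have hx := abs_le.1 T.offset_abs_le
  have h2 : p - τ + (t / 2 - x) ≤ 3.4 := by
    linarith [T.left_le, T.perimeter, T.t_le, T.lam_le, T.tau_pos, T.one_le_t, hx.1, hx.2]
  have h3 : 0 ≤ p - τ + (t / 2 - x) := by
    linarith [T.right_le, T.one_le_t, hx.1, hx.2]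
  have h4 : (p - τ - (t / 2 - x)) * (p - τ + (t / 2 - x)) ≤ 3.5 * ε * 3.4 := by
    have := T.eps_pos
    calc _ ≤ 3.5 * ε * (p - τ + (t / 2 - x)) := by gcongr
      _ ≤ _ := by gcongr
  nlinarith [T.L₂_sq, T.one_le_D_sq, T.eps_pos]

theorem left_diag_defect (T : TriangleData ε lam τ p q t D x L₁ L₂) :
    1 + (q - τ) ^ 2 - L₁ ^ 2 ≤ 12 * ε := by
  have h1 : q - τ - (t / 2 + x) ≤ 3.5 * ε := by
    linarith [T.right_le, T.top_gap, T.perimeter]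
  have hx := abs_le.1 T.offset_abs_le
  have h2 : q - τ + (t / 2 + x) ≤ 3.4 := by
    linarith [T.right_le, T.perimeter, T.t_le, T.lam_le, T.tau_pos, T.one_le_t, hx.1, hx.2]
  have h3 : 0 ≤ q - τ + (t / 2 + x) := by
    linarith [T.left_le, T.one_le_t, hx.1, hx.2]
  have h4 : (q - τ - (t / 2 + x)) * (q - τ + (t / 2 + x)) ≤ 3.5 * ε * 3.4 := by
    have := T.eps_pos
    calc _ ≤ 3.5 * ε * (q - τ + (t / 2 + x)) := by gcongr
      _ ≤ _ := by gcongr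
  nlinarith [T.L₁_sq, T.one_le_D_sq, T.eps_pos]

theorem abs_base_sub_le (T : TriangleData ε lam τ p q t D x L₁ L₂) :
    |t / 2 - Real.sqrt 3 / 3| ≤ ε := by
  have h3 : Real.sqrt 3 ^ 2 = 3 := Real.sq_sqrt (by norm_num)
  have h4 : 1.7 ≤ Real.sqrt 3 := by
    apply Real.le_sqrt_of_sq_le; norm_num
  have hε := T.eps_pos
  have hε' := T.eps_lt
  have l1 : 1 - 1.75 * ε ≤ lam * τ := by
    linarith [T.lam_tau_lower, T.one_le_D_sq, T.lam_sq_le]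
  have l2 : lam * τ ≤ 1 + 1.75 * ε := by
    linarith [T.lam_tau_upper, T.lam_sq_le]
  have u1 : 3 * τ ^ 2 ≤ 1 + 3.6 * ε := by
    have : 3 * τ ^ 2 ≤ lam ^ 2 * τ ^ 2 := by gcongr; exact T.three_le
    have : (lam * τ) ^ 2 ≤ (1 + 1.75 * ε) ^ 2 := by
      have := mul_pos T.lam_pos T.tau_pos
      gcongr
    nlinarith
  have u2 : 1 - 5 * ε ≤ 3 * τ ^ 2 := by
    have h6 : (1 - 1.75 * ε) ^ 2 ≤ (lam * τ) ^ 2 := by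
      have : 0 ≤ 1 - 1.75 * ε := by linarith
      gcongr
    have h7 : lam ^ 2 * τ ^ 2 ≤ (3 + 3.5 * ε) * τ ^ 2 := by gcongr; exact T.lam_sq_le
    have h8 : τ ^ 2 ≤ 0.36 := by nlinarith [T.tau_le, T.tau_pos]
    nlinarith
  have hd : (t / 2 - Real.sqrt 3 / 3) * (t / 2 + Real.sqrt 3 / 3) = (3 * τ ^ 2 - 1) / 12 := by
    linear_combination T.t_sq / 4 - h3 / 9
  have hs : 1 ≤ t / 2 + Real.sqrt 3 / 3 := by linarith [T.one_le_t]
  rw [abs_le]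
  constructor <;> nlinarith

end TriangleData

/-! ### Comparison with the equilateral triangle -/

theorem exists_combo_of_mem_convexHull {E : Type*} [AddCommGroup E] [Module ℝ E] {A B C X : E} :
    X ∈ convexHull ℝ {A, B, C} ↔
      ∃ u v w : ℝ, 0 ≤ u ∧ 0 ≤ v ∧ 0 ≤ w ∧ u + v + w = 1 ∧ X = u • A + v • B + w • C := by
  constructor
  · intro hX
    rw [convexHull_insert (by simp), convexHull_pair, mem_convexJoin] at hX
    obtain ⟨_, rfl, y, ⟨s, t, hs, ht, hst, rfl⟩, ⟨k, l, hk, hl, hkl, rfl⟩⟩ := hX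
    refine ⟨k, l * s, l * t, hk, mul_nonneg hl hs, mul_nonneg hl ht, ?_, by module⟩
    rw [add_assoc, ← mul_add, hst, mul_one, hkl]
  · rintro ⟨u, v, w, hu, hv, hw, hsum, rfl⟩
    have hc := convex_convexHull ℝ ({A, B, C} : Set E)
    have hA : A ∈ convexHull ℝ ({A, B, C} : Set E) := subset_convexHull _ _ (by simp)
    have hB : B ∈ convexHull ℝ ({A, B, C} : Set E) := subset_convexHull _ _ (by simp)
    have hC : C ∈ convexHull ℝ ({A, B, C} : Set E) := subset_convexHull _ _ (by simp)
    rcases hw.eq_or_lt with rfl | hw0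
    · rw [zero_smul, add_zero]
      exact hc hA hB hu hv (by linarith)
    rcases hu.eq_or_lt with rfl | hu0
    · rw [zero_smul, zero_add]
      exact hc hB hC hv hw (by linarith)
    have hs : 0 < v + w := by linarith
    have h1 := hc hB hC (a := v / (v + w)) (b := w / (v + w)) (by positivity) (by positivity)
      (by field_simp)
    have h2 := hc hA h1 hu hs.le (by linarith)
    rw [smul_add, smul_smul, smul_smul, mul_div_cancel₀ _ hs.ne', mul_div_cancel₀ _ hs.ne',
      ← add_assoc] at h2
    exact h2

/-- A number between `r * l` and `r * m` is a combination of `l` and `m` of total weight `r`. -/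
theorem exists_weights {r l m z : ℝ} (hr : 0 ≤ r) (hlm : l ≤ m) (h₁ : r * l ≤ z) (h₂ : z ≤ r * m) :
    ∃ u v : ℝ, 0 ≤ u ∧ 0 ≤ v ∧ u + v = r ∧ u * l + v * m = z := by
  rcases hlm.eq_or_lt with rfl | hlt
  · exact ⟨r, 0, hr, le_rfl, by ring, by linarith⟩
  · have hp : 0 < m - l := sub_pos.2 hlt
    refine ⟨(r * m - z) / (m - l), (z - r * l) / (m - l), div_nonneg (by linarith) hp.le,
      div_nonneg (by linarith) hp.le, ?_, ?_⟩
    · field_simp; ring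
    · field_simp; ring

namespace IsMoebius

variable {lam : ℝ} {F : ℝ × ℝ → Space}

theorem apply_add_one (h : IsMoebius lam F) (x : ℝ) : F (x + lam, 1) = F (x, 0) := by
  simpa using h.glue x 0 (by simp)

theorem apply_add_zero (h : IsMoebius lam F) (x : ℝ) : F (x + lam, 0) = F (x, 1) := by
  simpa using h.glue x 1 (by simp)

theorem norm_apply_combo_sub_le (h : IsMoebius lam F) {p q r : ℝ × ℝ}
    (hp : p.2 ∈ Icc (0 : ℝ) 1) (hq : q.2 ∈ Icc (0 : ℝ) 1) (hr : r.2 ∈ Icc (0 : ℝ) 1)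
    {P Q R : Space} {ε η : ℝ} (hε : 0 ≤ ε)
    (hpq : sqDist p q - ‖F p - F q‖ ^ 2 ≤ 12 * ε) (hqr : sqDist q r - ‖F q - F r‖ ^ 2 ≤ 12 * ε)
    (hpr : sqDist p r - ‖F p - F r‖ ^ 2 ≤ 12 * ε)
    (hP : ‖F p - P‖ ≤ η) (hQ : ‖F q - Q‖ ≤ η) (hR : ‖F r - R‖ ≤ η)
    {u v w : ℝ} (hu : 0 ≤ u) (hv : 0 ≤ v) (hw : 0 ≤ w) (hsum : u + v + w = 1) :
    ‖F (u • p + v • q + w • r) - (u • P + v • Q + w • R)‖ ≤ 2 * Real.sqrt ε + η := by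
  have h1 : ‖F (u • p + v • q + w • r) - (u • F p + v • F q + w • F r)‖ ≤ 2 * Real.sqrt ε := by
    apply le_of_sq_le_sq _ (by positivity)
    refine (h.norm_sub_combo_sq_le hp hq hr hu hv hw hsum).trans ?_
    rw [mul_pow, Real.sq_sqrt hε]
    have e1 := mul_le_mul_of_nonneg_left hpq (mul_nonneg hu hv)
    have e2 := mul_le_mul_of_nonneg_left hqr (mul_nonneg hv hw)
    have e3 := mul_le_mul_of_nonneg_left hpr (mul_nonneg hu hw)
    have e4 : 3 * (u * v + v * w + u * w) ≤ 1 := by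
      have : (u + v + w) ^ 2 = 1 := by rw [hsum]; norm_num
      nlinarith [sq_nonneg (u - v), sq_nonneg (v - w), sq_nonneg (u - w)]
    nlinarith
  have h2 : ‖(u • F p + v • F q + w • F r) - (u • P + v • Q + w • R)‖ ≤ η := by
    have e : (u • F p + v • F q + w • F r) - (u • P + v • Q + w • R)
        = u • (F p - P) + v • (F q - Q) + w • (F r - R) := by module
    rw [e]
    refine (norm_add₃_le).trans ?_
    rw [norm_smul, norm_smul, norm_smul, Real.norm_of_nonneg hu, Real.norm_of_nonneg hv,
      Real.norm_of_nonneg hw]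
    calc _ ≤ u * η + v * η + w * η := by gcongr
      _ = η := by rw [← add_mul, ← add_mul, hsum, one_mul]
  calc _ = ‖(F (u • p + v • q + w • r) - (u • F p + v • F q + w • F r))
        + ((u • F p + v • F q + w • F r) - (u • P + v • Q + w • R))‖ := by congr 1; abel
    _ ≤ _ := norm_add_le _ _
    _ ≤ _ := add_le_add h1 h2

namespace IsTriangle

variable {a b c α ε : ℝ} {w : Space}

theorem triangleData (T : IsTriangle lam F a b c α w) (h : IsMoebius lam F) (hε0 : 0 < ε)
    (hε : ε < 1 / 384) (hlam : lam < Real.sqrt 3 + ε) :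
    TriangleData ε lam (b - a) (c - a) (b + lam - c) ‖F (b, 1) - F (a, 0)‖ ‖w‖
      ((α - 1 / 2) * ‖F (b, 1) - F (a, 0)‖) ‖F (a, 0) - F (c, 0)‖ ‖F (c, 0) - F (b, 1)‖ := by
  have hz : (0 : ℝ) ∈ Icc (0 : ℝ) 1 := by simp
  have ho : (1 : ℝ) ∈ Icc (0 : ℝ) 1 := by simp
  have hpos := h.pos
  have hw := T.inner_eq
  set u := F (b, 1) - F (a, 0) with hu
  have hin : ⟪u, w⟫ = 0 := by rw [real_inner_comm, hw]
  have s1 : ‖F (a, 0) - F (c, 0)‖ ^ 2 = (α * ‖u‖) ^ 2 + ‖w‖ ^ 2 := by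
    rw [norm_sub_rev, T.eq, ← hu, show F (a, 0) + α • u + w - F (a, 0) = α • u + w by abel,
      norm_add_sq_real, inner_smul_left, hin, norm_smul, mul_pow, Real.norm_eq_abs, sq_abs,
      mul_pow]
    simp
  have s2 : ‖F (c, 0) - F (b, 1)‖ ^ 2 = ((α - 1) * ‖u‖) ^ 2 + ‖w‖ ^ 2 := by
    rw [T.eq, ← hu, show F (a, 0) + α • u + w - F (b, 1) = (α - 1) • u + w by rw [hu]; module,
      norm_add_sq_real, inner_smul_left, hin, norm_smul, mul_pow, Real.norm_eq_abs, sq_abs,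
      mul_pow]
    simp
  have d1 := h.norm_sub_sq_le (p := (a, 0)) (q := (c, 0)) hz hz
  have d2 := h.norm_sub_sq_le (p := (c, 0)) (q := (b + lam, 0)) hz hz
  have d3 := h.norm_sub_sq_le (p := (a + lam, 1)) (q := (c, 0)) ho hz
  have d4 := h.norm_sub_sq_le (p := (c, 0)) (q := (b, 1)) hz ho
  have d5 := h.norm_sub_sq_le (p := (b, 1)) (q := (a + lam, 1)) ho ho
  rw [h.apply_add_zero] at d2
  rw [h.apply_add_one] at d3 d5
  rw [← hu] at d5
  simp only [sqDist] at d1 d2 d3 d4 d5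
  have hl := T.left_le
  have hr := T.le_right
  have hb := T.le_add
  refine ⟨hε0, hε, hlam, hpos, by ring, ?_, ?_, ?_, T.one_le, norm_nonneg _, norm_nonneg _, ?_, ?_,
    ?_, ?_, ?_, ?_⟩
  · linarith [one_le_norm_of_isBend T.bend]
  · exact T.bend
  · apply le_of_sq_le_sq _ (by linarith)
    linarith
  · rw [s1]; ring
  · rw [s2]; ring
  · apply le_of_sq_le_sq _ (by linarith)
    linarith
  · apply le_of_sq_le_sq _ (by linarith)
    linarith
  · linarith
  · linarith

theorem exists_model (T : IsTriangle lam F a b c α w) (h : IsMoebius lam F) (hε0 : 0 < ε)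
    (hε : ε < 1 / 384) (hlam : lam < Real.sqrt 3 + ε) :
    ∃ A B C : Space, dist A B = 2 * Real.sqrt 3 / 3 ∧ dist B C = 2 * Real.sqrt 3 / 3 ∧
      dist C A = 2 * Real.sqrt 3 / 3 ∧ ‖F (a, 0) - A‖ ≤ 3 * Real.sqrt ε ∧
      ‖F (b, 1) - B‖ ≤ 3 * Real.sqrt ε ∧ ‖F (c, 0) - C‖ ≤ 3 * Real.sqrt ε := by
  have D := T.triangleData h hε0 hε hlam
  have h3 : Real.sqrt 3 ^ 2 = 3 := Real.sq_sqrt (by norm_num)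
  have hs3 := Real.sqrt_nonneg 3
  have hse : ε ≤ Real.sqrt ε := by
    apply Real.le_sqrt_of_sq_le
    nlinarith
  set u := F (b, 1) - F (a, 0) with hu
  set t := ‖u‖ with ht
  have ht0 := D.t_pos
  have hD1 := D.one_le
  set e : Space := t⁻¹ • u with he
  set n : Space := ‖w‖⁻¹ • w with hn
  have hee : ‖e‖ = 1 := by
    rw [he, norm_smul, norm_inv, Real.norm_of_nonneg ht0.le, ← ht, inv_mul_cancel₀ ht0.ne']
  have hnn : ‖n‖ = 1 := by
    rw [hn, norm_smul, norm_inv, norm_norm, inv_mul_cancel₀ (by linarith)]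
  have hen : ⟪e, n⟫ = 0 := by
    rw [he, hn, inner_smul_left, inner_smul_right, real_inner_comm, T.inner_eq]
    simp
  have hue : u = t • e := by rw [he, smul_smul, mul_inv_cancel₀ ht0.ne', one_smul]
  have hwn : w = ‖w‖ • n := by
    rw [hn, smul_smul, mul_inv_cancel₀ (by linarith), one_smul]
  set m : Space := F (a, 0) + (1 / 2 : ℝ) • u with hm
  have hlen : ∀ r : ℝ, r ^ 2 = 1 / 3 → ‖r • e + n‖ = 2 * Real.sqrt 3 / 3 := by
    intro r hr
    rw [← sq_eq_sq₀ (norm_nonneg _) (by positivity), norm_add_sq_real, inner_smul_left, hen,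
      norm_smul, hnn, hee, mul_one, Real.norm_eq_abs, sq_abs, hr, div_pow, mul_pow, h3]
    norm_num
  have hFb : F (b, 1) = F (a, 0) + u := by rw [hu]; abel
  have hbase := D.abs_base_sub_le
  refine ⟨m - (Real.sqrt 3 / 3) • e, m + (Real.sqrt 3 / 3) • e, m + n, ?_, ?_, ?_, ?_, ?_, ?_⟩
  · rw [dist_eq_norm, show m - (Real.sqrt 3 / 3) • e - (m + (Real.sqrt 3 / 3) • e)
      = (-(2 * Real.sqrt 3 / 3)) • e by module, norm_smul, hee, norm_neg, mul_one,
      Real.norm_of_nonneg (by positivity)]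
  · rw [dist_comm, dist_eq_norm, show m + n - (m + (Real.sqrt 3 / 3) • e)
      = (-(Real.sqrt 3 / 3)) • e + n by module]
    exact hlen _ (by rw [neg_sq, div_pow, h3]; norm_num)
  · rw [dist_eq_norm, show m + n - (m - (Real.sqrt 3 / 3) • e)
      = (Real.sqrt 3 / 3) • e + n by module]
    exact hlen _ (by rw [div_pow, h3]; norm_num)
  · rw [show F (a, 0) - (m - (Real.sqrt 3 / 3) • e) = (-(t / 2 - Real.sqrt 3 / 3)) • e by
      rw [hm, hue]; module, norm_smul, hee, norm_neg, mul_one, Real.norm_eq_abs]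
    linarith
  · rw [show F (b, 1) - (m + (Real.sqrt 3 / 3) • e) = (t / 2 - Real.sqrt 3 / 3) • e by
      rw [hm, hFb, hue]; module, norm_smul, hee, mul_one, Real.norm_eq_abs]
    linarith
  · have hx : |(α - 1 / 2) * t| ≤ 2 * Real.sqrt ε := by
      apply abs_le_of_sq_le_sq _ (by positivity)
      rw [mul_pow 2, Real.sq_sqrt hε0.le]
      linarith [D.offset_sq_le]
    have hFc : F (c, 0) - (m + n) = ((α - 1 / 2) * t) • e + (‖w‖ - 1) • n := by
      rw [T.eq, ← hu, hm]
      nth_rewrite 1 [hwn]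
      rw [hue]
      module
    rw [hFc]
    refine (norm_add_le _ _).trans ?_
    rw [norm_smul _ e, norm_smul _ n, hee, hnn, mul_one, mul_one, Real.norm_eq_abs,
      Real.norm_of_nonneg (by linarith)]
    linarith [D.D_le]

/-- Every point of the band lies in one of the three triangles cut out by the bend and the apex. -/
theorem exists_combo (T : IsTriangle lam F a b c α w) (h : IsMoebius lam F) {x y : ℝ}
    (hy : y ∈ Icc (0 : ℝ) 1) :
    ∃ u v k : ℝ, 0 ≤ u ∧ 0 ≤ v ∧ 0 ≤ k ∧ u + v + k = 1 ∧
      (F (x, y) = F (u • (a, 0) + v • (b, 1) + k • (c, 0)) ∨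
        F (x, y) = F (u • (a + lam, 1) + v • (b, 1) + k • (c, 0)) ∨
        F (x, y) = F (u • (a + lam, 1) + v • (b + lam, 0) + k • (c, 0))) := by
  have hpos := h.pos
  have hl := T.left_le
  have hr := T.le_right
  have hb := T.le_add
  -- points between the bend and its image under the glue map
  have main : ∀ {x y : ℝ}, y ∈ Icc (0 : ℝ) 1 → (1 - y) * a + y * b ≤ x →
      x ≤ (1 - y) * (b + lam) + y * (a + lam) →
      ∃ u v k : ℝ, 0 ≤ u ∧ 0 ≤ v ∧ 0 ≤ k ∧ u + v + k = 1 ∧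
      (F (x, y) = F (u • (a, 0) + v • (b, 1) + k • (c, 0)) ∨
        F (x, y) = F (u • (a + lam, 1) + v • (b, 1) + k • (c, 0)) ∨
        F (x, y) = F (u • (a + lam, 1) + v • (b + lam, 0) + k • (c, 0))) := by
    intro x y hy hx0 hx1
    have hy1 : 0 ≤ 1 - y := sub_nonneg.2 hy.2
    rcases le_total x ((1 - y) * c + y * b) with h1 | h1
    · obtain ⟨u, k, hu, hk, huk, hz⟩ := exists_weights (z := x - y * b) hy1 hl (by linarith)
        (by linarith)
      refine ⟨u, y, k, hu, hy.1, hk, by linarith, Or.inl ?_⟩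
      congr 1
      ext <;> simp
      linarith
    rcases le_total x ((1 - y) * c + y * (a + lam)) with h2 | h2
    · obtain ⟨v, u, hv, hu, huv, hz⟩ := exists_weights (z := x - (1 - y) * c) hy.1 hb (by linarith)
        (by linarith)
      refine ⟨u, v, 1 - y, hu, hv, hy1, by linarith, Or.inr (Or.inl ?_)⟩
      congr 1
      ext <;> simp <;> linarith
    · obtain ⟨k, v, hk, hv, hkv, hz⟩ := exists_weights (z := x - y * (a + lam)) hy1 hr
        (by linarith) (by linarith)
      refine ⟨y, v, k, hy.1, hv, hk, by linarith, Or.inr (Or.inr ?_)⟩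
      congr 1
      ext <;> simp
      linarith
  set N : ℤ := ⌊(x - ((1 - y) * a + y * b)) / (2 * lam)⌋
  set r : ℝ := x + (-N : ℤ) * (2 * lam) with hrdef
  have hr0 : (1 - y) * a + y * b ≤ r := by
    have := Int.floor_le ((x - ((1 - y) * a + y * b)) / (2 * lam))
    rw [le_div_iff₀ (by linarith)] at this
    simp only [hrdef, N]; push_cast; linarith
  have hr1 : r < (1 - y) * a + y * b + 2 * lam := by
    have := Int.lt_floor_add_one ((x - ((1 - y) * a + y * b)) / (2 * lam))
    rw [div_lt_iff₀ (by linarith)] at this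
    simp only [hrdef, N]; push_cast; linarith
  have hF : F (x, y) = F (r, y) := (h.add_int_mul (-N) x hy).symm
  rw [hF]
  rcases le_total r ((1 - y) * (b + lam) + y * (a + lam)) with h1 | h1
  · exact main hy hr0 h1
  · have hy' : 1 - y ∈ Icc (0 : ℝ) 1 := ⟨by linarith [hy.2], by linarith [hy.1]⟩
    have := h.glue (r - lam) (1 - y) hy'
    rw [sub_add_cancel, sub_sub_cancel] at this
    rw [this]
    exact main hy' (by linarith) (by linarith)

end IsTriangle

/-- An embedded band of almost minimal aspect ratio is close to an equilateral triangle. -/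
theorem exists_equilateral_hausdorffDist_le (h : IsMoebius lam F) (hF : IsEmbedded lam F) {ε : ℝ}
    (hε0 : 0 < ε) (hε : ε < 1 / 384) (hlam : lam < Real.sqrt 3 + ε) :
    ∃ A B C : Space, dist A B = 2 * Real.sqrt 3 / 3 ∧ dist B C = 2 * Real.sqrt 3 / 3 ∧
      dist C A = 2 * Real.sqrt 3 / 3 ∧
      Metric.hausdorffDist (F '' (univ ×ˢ Icc (0 : ℝ) 1)) (convexHull ℝ {A, B, C}) ≤
        5 * Real.sqrt ε := by
  obtain ⟨a, b, c, α, w, T⟩ := h.exists_isTriangle hF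
  have D := T.triangleData h hε0 hε hlam
  obtain ⟨A, B, C, hAB, hBC, hCA, hA, hB, hC⟩ := T.exists_model h hε0 hε hlam
  refine ⟨A, B, C, hAB, hBC, hCA, ?_⟩
  have hz : (0 : ℝ) ∈ Icc (0 : ℝ) 1 := by simp
  have ho : (1 : ℝ) ∈ Icc (0 : ℝ) 1 := by simp
  have hA' : ‖F (a + lam, 1) - A‖ ≤ 3 * Real.sqrt ε := by rwa [h.apply_add_one]
  have hB' : ‖F (b + lam, 0) - B‖ ≤ 3 * Real.sqrt ε := by rwa [h.apply_add_zero]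
  have f1 := D.t_sq
  have f2 := D.left_defect
  have f3 := D.right_defect
  have f4 := D.left_diag_defect
  have f5 := D.right_diag_defect
  have f6 := D.top_defect
  have e1 : ∀ {u v k : ℝ}, 0 ≤ u → 0 ≤ v → 0 ≤ k → u + v + k = 1 →
      ‖F (u • (a, 0) + v • (b, 1) + k • (c, 0)) - (u • A + v • B + k • C)‖ ≤
        5 * Real.sqrt ε := by
    intro u v k hu hv hk hsum
    refine (h.norm_apply_combo_sub_le (p := (a, 0)) (q := (b, 1)) (r := (c, 0)) hz ho hz hε0.le
      ?_ ?_ ?_ hA hB hC hu hv hk hsum).trans (by linarith)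
    · rw [norm_sub_rev]; simp only [sqDist]; linarith
    · rw [norm_sub_rev]; simp only [sqDist]; linarith
    · simp only [sqDist]; linarith
  have e2 : ∀ {u v k : ℝ}, 0 ≤ u → 0 ≤ v → 0 ≤ k → u + v + k = 1 →
      ‖F (u • (a + lam, 1) + v • (b, 1) + k • (c, 0)) - (u • A + v • B + k • C)‖ ≤
        5 * Real.sqrt ε := by
    intro u v k hu hv hk hsum
    refine (h.norm_apply_combo_sub_le (p := (a + lam, 1)) (q := (b, 1)) (r := (c, 0)) ho ho hz
      hε0.le ?_ ?_ ?_ hA' hB hC hu hv hk hsum).trans (by linarith)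
    · rw [norm_sub_rev, h.apply_add_one]; simp only [sqDist]; linarith
    · rw [norm_sub_rev]; simp only [sqDist]; linarith
    · rw [h.apply_add_one]; simp only [sqDist]; linarith
  have e3 : ∀ {u v k : ℝ}, 0 ≤ u → 0 ≤ v → 0 ≤ k → u + v + k = 1 →
      ‖F (u • (a + lam, 1) + v • (b + lam, 0) + k • (c, 0)) - (u • A + v • B + k • C)‖ ≤
        5 * Real.sqrt ε := by
    intro u v k hu hv hk hsum
    refine (h.norm_apply_combo_sub_le (p := (a + lam, 1)) (q := (b + lam, 0)) (r := (c, 0)) ho hz hz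
      hε0.le ?_ ?_ ?_ hA' hB' hC hu hv hk hsum).trans (by linarith)
    · rw [norm_sub_rev, h.apply_add_one, h.apply_add_zero]; simp only [sqDist]; linarith
    · rw [norm_sub_rev, h.apply_add_zero]; simp only [sqDist]; linarith
    · rw [h.apply_add_one]; simp only [sqDist]; linarith
  refine Metric.hausdorffDist_le_of_mem_dist (by positivity) ?_ ?_
  · rintro _ ⟨⟨x, y⟩, hxy, rfl⟩
    obtain ⟨u, v, k, hu, hv, hk, hsum, hp⟩ := T.exists_combo h (x := x) hxy.2
    refine ⟨u • A + v • B + k • C,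
      exists_combo_of_mem_convexHull.2 ⟨u, v, k, hu, hv, hk, hsum, rfl⟩, ?_⟩
    rw [dist_eq_norm]
    rcases hp with hp | hp | hp <;> rw [hp]
    exacts [e1 hu hv hk hsum, e2 hu hv hk hsum, e3 hu hv hk hsum]
  · intro X hX
    obtain ⟨u, v, k, hu, hv, hk, hsum, rfl⟩ := exists_combo_of_mem_convexHull.1 hX
    refine ⟨_, ⟨u • (a, 0) + v • (b, 1) + k • (c, 0), ⟨mem_univ _, ?_⟩, rfl⟩, ?_⟩
    · simp only [Prod.snd_add, Prod.smul_snd, smul_eq_mul, mul_zero, mul_one, zero_add, add_zero]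
      exact ⟨hv, by linarith⟩
    · rw [dist_comm, dist_eq_norm]
      exact e1 hu hv hk hsum

end IsMoebius

end PaperBand

/-- **Main Corollary.** If `0 < ε < 1/384` and `f` encodes a smooth embedded paper
Moebius band of aspect ratio `lam < √3 + ε`, with image `Ω = f '' (ℝ × [0,1])`,
then `Ω` is within Hausdorff distance `18√ε` of an equilateral triangle of
perimeter `2√3`, i.e. `convexHull ℝ {A, B, C}` with pairwise distances `2√3/3`. -/
theorem hausdorff_close_to_equilateral_triangle
    (ε lam : ℝ) (hε0 : 0 < ε) (hε : ε < 1 / 384)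
    (hlam : 0 < lam)
    (f : ℝ → ℝ → EuclideanSpace ℝ (Fin 3))
    (hsmooth : ContDiff ℝ (⊤ : ℕ∞) (fun p : ℝ × ℝ => f p.1 p.2))
    (hglue : ∀ x : ℝ, ∀ y ∈ Set.Icc (0 : ℝ) 1, f (x + lam) (1 - y) = f x y)
    (hisom : ∀ p : ℝ × ℝ, p.2 ∈ Set.Icc (0 : ℝ) 1 → ∀ v : ℝ × ℝ,
      ‖fderiv ℝ (fun q : ℝ × ℝ => f q.1 q.2) p v‖ = Real.sqrt (v.1 ^ 2 + v.2 ^ 2))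
    (hinj : ∀ x x' y y' : ℝ, x ∈ Set.Ico (0 : ℝ) lam → x' ∈ Set.Ico (0 : ℝ) lam →
      y ∈ Set.Icc (0 : ℝ) 1 → y' ∈ Set.Icc (0 : ℝ) 1 →
      f x y = f x' y' → x = x' ∧ y = y')
    (hratio : lam < Real.sqrt 3 + ε) :
    ∃ A B C : EuclideanSpace ℝ (Fin 3),
      dist A B = 2 * Real.sqrt 3 / 3 ∧ dist B C = 2 * Real.sqrt 3 / 3 ∧
      dist C A = 2 * Real.sqrt 3 / 3 ∧
      Metric.hausdorffDist
        ((fun p : ℝ × ℝ => f p.1 p.2) '' (Set.univ ×ˢ Set.Icc (0 : ℝ) 1))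
        (convexHull ℝ {A, B, C}) ≤ 18 * Real.sqrt ε := by
  have h : PaperBand.IsMoebius lam (fun p : ℝ × ℝ => f p.1 p.2) := ⟨hlam, hsmooth, hglue, hisom⟩
  obtain ⟨A, B, C, hAB, hBC, hCA, hd⟩ := h.exists_equilateral_hausdorffDist_le hinj hε0 hε hratio
  exact ⟨A, B, C, hAB, hBC, hCA, hd.trans (by linarith [Real.sqrt_nonneg ε])⟩
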